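/- arXiv:2602.19014 — 2 statements merged into one kernel-verified Lean document; each statement's English description precedes it below -/
import Mathlib

section
/- Let Γ be a discrete abelian group and A, B ⊆ Γ nonempty. Then there exists a finite-index subgroup K ≤ Γ (depending only on A and B) with the following property: for every full Følner net Φ = (Φ_i)_{i∈I} for Γ with δ := d_Φ(A) + d_Φ(B) − d_Φ(A+B) > 0, there is a full Følner net Ψ = (Ψ_i)_{i∈I} indexed by the same directed set I, with Ψ_i ⊆ Φ_i for all i ∈ I, such that: (1) liminf_i |Ψ_i|/|Φ_i| ≥ [Γ:K]·δ; (2) d_Ψ(A+B) = d_Ψ(A+B+K); (3) d_Ψ(A) + d_Ψ(B) − d_Ψ(A+B) ≥ δ. -/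
open scoped Pointwise
open Filter

namespace SumsetMeans

variable (Γ : Type*) [AddCommGroup Γ] [TopologicalSpace Γ] [DiscreteTopology Γ]

/-- The indicator function of `A ⊆ Γ` as a bounded (continuous, since `Γ` is discrete)
real-valued function, i.e. as an element of `ℓ^∞(Γ)`. -/
noncomputable def ind (A : Set Γ) : BoundedContinuousFunction Γ ℝ :=
  BoundedContinuousFunction.ofNormedAddCommGroup (Set.indicator A 1)
    continuous_of_discreteTopology 1
    (fun x => by by_cases h : x ∈ A <;> simp [Set.indicator_apply, h])

/-- The translate `τ_γ f`, given by `(τ_γ f)(x) = f (x - γ)`. -/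
noncomputable def translate (γ : Γ) (f : BoundedContinuousFunction Γ ℝ) :
    BoundedContinuousFunction Γ ℝ :=
  f.compContinuous ⟨fun x => x - γ, continuous_of_discreteTopology⟩

/-- An invariant mean on `ℓ^∞(Γ)`: a linear functional with `m 1 = 1`, nonnegative on
nonnegative functions, and invariant under all translations. -/
structure IsInvariantMean (m : BoundedContinuousFunction Γ ℝ →ₗ[ℝ] ℝ) : Prop where
  map_one : m 1 = 1
  nonneg : ∀ f : BoundedContinuousFunction Γ ℝ, (∀ x, 0 ≤ f x) → 0 ≤ m f
  invariant : ∀ (γ : Γ) (f : BoundedContinuousFunction Γ ℝ), m (translate Γ γ f) = m f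

/-- The value `m(A) := m(1_A)` of a mean on a set `A ⊆ Γ`. -/
noncomputable def mVal (m : BoundedContinuousFunction Γ ℝ →ₗ[ℝ] ℝ) (A : Set Γ) : ℝ :=
  m (ind Γ A)

/-- Upper Banach density: `d*(A) = sup { m(A) : m an invariant mean on ℓ^∞(Γ) }`. -/
noncomputable def ubd (A : Set Γ) : ℝ :=
  sSup {x : ℝ | ∃ m, IsInvariantMean Γ m ∧ mVal Γ m A = x}

/-- An extreme invariant mean: an extreme point of the convex set of invariant means. -/
def IsExtremeInvariantMean (ν : BoundedContinuousFunction Γ ℝ →ₗ[ℝ] ℝ) : Prop :=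
  ν ∈ Set.extremePoints ℝ {m : BoundedContinuousFunction Γ ℝ →ₗ[ℝ] ℝ | IsInvariantMean Γ m}

variable {ι : Type*}

/-- The density of `C` in the finite set `F i`, i.e. `|C ∩ F i| / |F i|`. -/
noncomputable def dens (F : ι → Finset Γ) (C : Set Γ) (i : ι) : ℝ :=
  ((C ∩ (F i : Set Γ)).ncard : ℝ) / ((F i).card : ℝ)

/-- A Følner net (indexed by a preorder `ι`, typically directed and nonempty):
nonempty finite sets asymptotically invariant under every translation, along `atTop`. -/
def IsFolner [Preorder ι] (F : ι → Finset Γ) : Prop :=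
  (∀ i, (F i).Nonempty) ∧
  ∀ t : Γ, Tendsto (fun i =>
      ((symmDiff ((F i : Set Γ)) ((F i : Set Γ) + ({t} : Set Γ))).ncard : ℝ) / ((F i).card : ℝ))
    atTop (nhds 0)

/-- A net of finite sets is full if for every bounded function `f` the averages
along the net converge. -/
def IsFullNet [Preorder ι] (F : ι → Finset Γ) : Prop :=
  ∀ f : BoundedContinuousFunction Γ ℝ,
    ∃ L : ℝ, Tendsto (fun i => (∑ γ ∈ F i, f γ) / ((F i).card : ℝ)) atTop (nhds L)

section Functionals

variable {G : Type*}

/-- The real-valued indicator function of a set. -/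
noncomputable def chi (S : Set G) : G → ℝ := S.indicator 1

/-- Boundedness of a real-valued function. -/
def Bdd (f : G → ℝ) : Prop := ∃ C : ℝ, ∀ x, |f x| ≤ C

lemma chi_of_mem {S : Set G} {x : G} (h : x ∈ S) : chi S x = 1 := by simp [chi, h]

lemma chi_of_notMem {S : Set G} {x : G} (h : x ∉ S) : chi S x = 0 := by simp [chi, h]

lemma chi_nonneg (S : Set G) (x : G) : 0 ≤ chi S x := by
  by_cases h : x ∈ S <;> simp [chi, h]

lemma chi_le_one (S : Set G) (x : G) : chi S x ≤ 1 := by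
  by_cases h : x ∈ S <;> simp [chi, h]

lemma chi_mono {S T : Set G} (h : S ⊆ T) (x : G) : chi S x ≤ chi T x := by
  by_cases hx : x ∈ S
  · rw [chi_of_mem hx, chi_of_mem (h hx)]
  · rw [chi_of_notMem hx]; exact chi_nonneg T x

lemma chi_univ : chi (Set.univ : Set G) = fun _ => 1 := by
  ext; simp [chi]

lemma chi_compl (S : Set G) (x : G) : chi Sᶜ x = 1 - chi S x := by
  by_cases h : x ∈ S <;> simp [chi, h]

lemma chi_union_add_inter (S T : Set G) (x : G) :
    chi (S ∪ T) x + chi (S ∩ T) x = chi S x + chi T x := by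
  by_cases h : x ∈ S <;> by_cases h' : x ∈ T <;> simp [chi, h, h']

lemma chi_inter (S T : Set G) (x : G) : chi (S ∩ T) x = chi S x * chi T x := by
  by_cases h : x ∈ S <;> by_cases h' : x ∈ T <;> simp [chi, h, h']

lemma Bdd.of_mem_Icc {f : G → ℝ} {C : ℝ} (h0 : ∀ x, 0 ≤ f x) (h1 : ∀ x, f x ≤ C) : Bdd f :=
  ⟨C, fun x => abs_le.2 ⟨by linarith [h0 x, h1 x], h1 x⟩⟩

lemma bdd_chi (S : Set G) : Bdd (chi S) := .of_mem_Icc (chi_nonneg S) (chi_le_one S)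

lemma bdd_const (c : ℝ) : Bdd (fun _ : G => c) := ⟨|c|, fun _ => le_rfl⟩

lemma Bdd.add {f g : G → ℝ} (hf : Bdd f) (hg : Bdd g) : Bdd (fun x => f x + g x) := by
  obtain ⟨C, hC⟩ := hf
  obtain ⟨D, hD⟩ := hg
  exact ⟨C + D, fun x => (abs_add_le _ _).trans (add_le_add (hC x) (hD x))⟩

lemma Bdd.mul {f g : G → ℝ} (hf : Bdd f) (hg : Bdd g) : Bdd (fun x => f x * g x) := by
  obtain ⟨C, hC⟩ := hf
  obtain ⟨D, hD⟩ := hg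
  refine ⟨C * D, fun x => ?_⟩
  rw [abs_mul]
  exact mul_le_mul (hC x) (hD x) (abs_nonneg _) ((abs_nonneg _).trans (hC x))

lemma Bdd.const_mul {f : G → ℝ} (c : ℝ) (hf : Bdd f) : Bdd (fun x => c * f x) :=
  (bdd_const c).mul hf

lemma Bdd.sub {f g : G → ℝ} (hf : Bdd f) (hg : Bdd g) : Bdd (fun x => f x - g x) := by
  convert hf.add (hg.const_mul (-1)) using 2
  ring

lemma Bdd.comp {f : G → ℝ} (hf : Bdd f) {X : Type*} (k : X → G) : Bdd (fun x => f (k x)) := by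
  obtain ⟨C, hC⟩ := hf
  exact ⟨C, fun x => hC _⟩

/-- A functional that is linear and positive on bounded functions. -/
structure PosLin (M : (G → ℝ) → ℝ) : Prop where
  add : ∀ f g, Bdd f → Bdd g → M (fun x => f x + g x) = M f + M g
  const_mul : ∀ c f, Bdd f → M (fun x => c * f x) = c * M f
  nonneg : ∀ f, Bdd f → (∀ x, 0 ≤ f x) → 0 ≤ M f

namespace PosLin

variable {M : (G → ℝ) → ℝ} (hM : PosLin M)
include hM

lemma sub {f g : G → ℝ} (hf : Bdd f) (hg : Bdd g) : M (fun x => f x - g x) = M f - M g := by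
  have h := hM.add f _ hf (hg.const_mul (-1))
  rw [hM.const_mul _ _ hg] at h
  rw [show (fun x => f x - g x) = fun x => f x + -1 * g x by ext; ring, h]
  ring

lemma mono {f g : G → ℝ} (hf : Bdd f) (hg : Bdd g) (h : ∀ x, f x ≤ g x) : M f ≤ M g := by
  have := hM.nonneg _ (hg.sub hf) fun x => sub_nonneg.2 (h x)
  rw [hM.sub hg hf] at this
  linarith

lemma const (c : ℝ) : M (fun _ => c) = c * M (fun _ => 1) := by
  rw [← hM.const_mul c _ (bdd_const 1)]
  simp

lemma zero : M (fun _ => 0) = 0 := by rw [hM.const 0, zero_mul]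

lemma chi_empty : M (chi ∅) = 0 := by
  rw [← hM.zero]; congr 1; ext; simp [chi]

lemma abs_le {f : G → ℝ} {C : ℝ} (h : ∀ x, |f x| ≤ C) : |M f| ≤ C * M (fun _ => 1) := by
  have hf : Bdd f := ⟨C, h⟩
  rw [← hM.const, _root_.abs_le, ← neg_one_mul, ← hM.const_mul _ _ (bdd_const C)]
  exact ⟨hM.mono ((bdd_const C).const_mul _) hf fun x => by linarith [(_root_.abs_le.1 (h x)).1],
    hM.mono hf (bdd_const C) fun x => (_root_.abs_le.1 (h x)).2⟩

lemma chi_nonneg (S : Set G) : 0 ≤ M (chi S) := hM.nonneg _ (bdd_chi S) (SumsetMeans.chi_nonneg S)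

lemma chi_mono {S T : Set G} (h : S ⊆ T) : M (chi S) ≤ M (chi T) :=
  hM.mono (bdd_chi S) (bdd_chi T) (SumsetMeans.chi_mono h)

lemma chi_union_add_inter (S T : Set G) :
    M (chi (S ∪ T)) + M (chi (S ∩ T)) = M (chi S) + M (chi T) := by
  rw [← hM.add _ _ (bdd_chi _) (bdd_chi _), ← hM.add _ _ (bdd_chi _) (bdd_chi _)]
  congr 1; ext; apply SumsetMeans.chi_union_add_inter

lemma chi_union_le (S T : Set G) : M (chi (S ∪ T)) ≤ M (chi S) + M (chi T) := by
  linarith [hM.chi_union_add_inter S T, hM.chi_nonneg (S ∩ T)]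

lemma chi_union {S T : Set G} (h : Disjoint S T) :
    M (chi (S ∪ T)) = M (chi S) + M (chi T) := by
  rw [← hM.chi_union_add_inter, h.inter_eq, hM.chi_empty, add_zero]

lemma chi_inter_add_diff (S T : Set G) : M (chi (S ∩ T)) + M (chi (S \ T)) = M (chi S) := by
  rw [← hM.chi_union (Set.disjoint_left.2 fun x hx hx' => hx'.2 hx.2), Set.inter_union_sdiff]

lemma chi_compl (S : Set G) : M (chi Sᶜ) = M (fun _ => 1) - M (chi S) := by
  rw [← hM.sub (bdd_const 1) (bdd_chi S)]
  congr 1; ext; apply SumsetMeans.chi_compl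

lemma chi_eq_zero_of_subset {S T : Set G} (h : S ⊆ T) (hT : M (chi T) = 0) : M (chi S) = 0 :=
  le_antisymm (hT ▸ hM.chi_mono h) (hM.chi_nonneg S)

lemma chi_union_eq_zero {S T : Set G} (hS : M (chi S) = 0) (hT : M (chi T) = 0) :
    M (chi (S ∪ T)) = 0 :=
  le_antisymm (by linarith [hM.chi_union_le S T]) (hM.chi_nonneg _)

lemma chi_biUnion_eq_zero {X : Type*} (s : Finset X) (S : X → Set G)
    (h : ∀ x ∈ s, M (chi (S x)) = 0) : M (chi (⋃ x ∈ s, S x)) = 0 := by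
  classical
  induction s using Finset.induction_on with
  | empty => simpa using hM.chi_empty
  | insert a s _ ih =>
    rw [Finset.set_biUnion_insert]
    exact hM.chi_union_eq_zero (h a (by simp)) (ih fun x hx => h x (by simp [hx]))

lemma chi_biUnion {X : Type*} (s : Finset X) (S : X → Set G)
    (h : ∀ x ∈ s, ∀ y ∈ s, x ≠ y → M (chi (S x ∩ S y)) = 0) :
    M (chi (⋃ x ∈ s, S x)) = ∑ x ∈ s, M (chi (S x)) := by
  classical
  induction s using Finset.induction_on with
  | empty => simpa using hM.chi_empty
  | insert a s ha ih =>
    rw [Finset.set_biUnion_insert, Finset.sum_insert ha,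
      ← ih fun x hx y hy => h x (by simp [hx]) y (by simp [hy]), ← hM.chi_union_add_inter,
      Set.inter_iUnion₂, hM.chi_biUnion_eq_zero, add_zero]
    exact fun x hx => h a (by simp) x (by simp [hx]) (by rintro rfl; exact ha hx)

lemma chi_le_of_diff_eq_zero {S T : Set G} (h : M (chi (S \ T)) = 0) :
    M (chi S) ≤ M (chi T) := by
  rw [← hM.chi_inter_add_diff S T, h, add_zero]
  exact hM.chi_mono Set.inter_subset_right

/-- A positive functional can be restricted to the limit of a decreasing sequence of sets. -/
lemma exists_restrict (E : ℕ → Set G) (hE : Antitone E) :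
    ∃ N : (G → ℝ) → ℝ, PosLin N ∧
      (∀ f, Bdd f → Tendsto (fun n => M (fun x => f x * chi (E n) x)) atTop (nhds (N f))) := by
  have key : ∀ f, Bdd f → ∃ L, Tendsto (fun n => M (fun x => f x * chi (E n) x)) atTop (nhds L) := by
    intro f hf
    obtain ⟨C, hC⟩ := hf
    have hf : Bdd f := ⟨C, hC⟩
    have hb : ∀ n, Bdd fun x => f x * chi (E n) x := fun n => hf.mul (bdd_chi _)
    have hanti : Antitone fun n => M (fun x => (f x + C) * chi (E n) x) := fun m n hmn =>
      hM.mono ((hf.add (bdd_const C)).mul (bdd_chi _)) ((hf.add (bdd_const C)).mul (bdd_chi _))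
        fun x => mul_le_mul_of_nonneg_left (SumsetMeans.chi_mono (hE hmn) x)
          (by linarith [(_root_.abs_le.1 (hC x)).1])
    have hanti' : Antitone fun n => M (chi (E n)) := fun m n hmn => hM.chi_mono (hE hmn)
    have h1 := tendsto_atTop_ciInf hanti ⟨0, by
      rintro _ ⟨n, rfl⟩
      exact hM.nonneg _ ((hf.add (bdd_const C)).mul (bdd_chi _)) fun x =>
        mul_nonneg (by linarith [(_root_.abs_le.1 (hC x)).1]) (SumsetMeans.chi_nonneg _ x)⟩
    have h2 := tendsto_atTop_ciInf hanti' ⟨0, by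
      rintro _ ⟨n, rfl⟩; exact hM.chi_nonneg _⟩
    refine ⟨_, (h1.sub (h2.const_mul C)).congr fun n => ?_⟩
    rw [← hM.const_mul C _ (bdd_chi _), ← hM.sub ((hf.add (bdd_const C)).mul (bdd_chi _))
      ((bdd_chi _).const_mul C)]
    congr 1; ext; ring
  choose! N hN using key
  refine ⟨N, ⟨fun f g hf hg => ?_, fun c f hf => ?_, fun f hf h0 => ?_⟩, hN⟩
  · refine tendsto_nhds_unique (hN _ (hf.add hg)) (((hN f hf).add (hN g hg)).congr fun n => ?_)
    rw [← hM.add _ _ (hf.mul (bdd_chi _)) (hg.mul (bdd_chi _))]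
    congr 1; ext; ring
  · refine tendsto_nhds_unique (hN _ (hf.const_mul c)) (((hN f hf).const_mul c).congr fun n => ?_)
    rw [← hM.const_mul _ _ (hf.mul (bdd_chi _))]
    congr 1; ext; ring
  · exact ge_of_tendsto' (hN f hf) fun n => hM.nonneg _ (hf.mul (bdd_chi _)) fun x =>
      mul_nonneg (h0 x) (SumsetMeans.chi_nonneg _ x)

end PosLin

end Functionals

section InvariantMeans

variable {G : Type*} [AddCommGroup G]

/-- A positive linear functional on bounded functions which is invariant under translations. -/
structure PosInv (M : (G → ℝ) → ℝ) : Prop extends PosLin M where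
  shift : ∀ t f, Bdd f → M (fun x => f (x + t)) = M f

/-- The invariant means, extended by zero to unbounded functions. -/
def invMeans (G : Type*) [AddCommGroup G] : Set ((G → ℝ) → ℝ) :=
  {M | PosInv M ∧ M (fun _ => 1) = 1 ∧ ∀ f, ¬ Bdd f → M f = 0}

lemma isCompact_invMeans : IsCompact (invMeans G) := by
  classical
  let b : (G → ℝ) → ℝ := fun f => if h : Bdd f then h.choose else 0
  refine (isCompact_univ_pi fun f => isCompact_Icc (a := -b f) (b := b f)).of_isClosed_subset
    ?_ ?_
  · have h : invMeans G =
        (⋂ (f) (g) (_ : Bdd f) (_ : Bdd g), {M | M (fun x => f x + g x) = M f + M g}) ∩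
        (⋂ (c : ℝ) (f) (_ : Bdd f), {M | M (fun x => c * f x) = c * M f}) ∩
        (⋂ (f) (_ : Bdd f) (_ : ∀ x, 0 ≤ f x), {M | 0 ≤ M f}) ∩
        (⋂ (t) (f) (_ : Bdd f), {M | M (fun x => f (x + t)) = M f}) ∩
        {M | M (fun _ => 1) = 1} ∩ ⋂ (f) (_ : ¬ Bdd f), {M | M f = 0} := by
      ext M
      simp only [Set.mem_inter_iff, Set.mem_iInter, Set.mem_ofPred_eq, invMeans]
      exact ⟨fun ⟨⟨⟨h1, h2, h3⟩, h4⟩, h5, h6⟩ => ⟨⟨⟨⟨⟨h1, h2⟩, h3⟩, h4⟩, h5⟩, h6⟩,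
        fun ⟨⟨⟨⟨⟨h1, h2⟩, h3⟩, h4⟩, h5⟩, h6⟩ => ⟨⟨⟨h1, h2, h3⟩, h4⟩, h5, h6⟩⟩
    rw [h]
    refine ((((IsClosed.inter ?_ ?_).inter ?_).inter ?_).inter ?_).inter ?_
    · exact isClosed_iInter fun f => isClosed_iInter fun g => isClosed_iInter fun _ =>
        isClosed_iInter fun _ => isClosed_eq (continuous_apply _)
          ((continuous_apply f).add (continuous_apply g))
    · exact isClosed_iInter fun c => isClosed_iInter fun f => isClosed_iInter fun _ =>
        isClosed_eq (continuous_apply _) (continuous_const.mul (continuous_apply _))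
    · exact isClosed_iInter fun f => isClosed_iInter fun _ => isClosed_iInter fun _ =>
        isClosed_le continuous_const (continuous_apply _)
    · exact isClosed_iInter fun t => isClosed_iInter fun f => isClosed_iInter fun _ =>
        isClosed_eq (continuous_apply _) (continuous_apply _)
    · exact isClosed_eq (continuous_apply _) continuous_const
    · exact isClosed_iInter fun f => isClosed_iInter fun _ =>
        isClosed_eq (continuous_apply _) continuous_const
  · rintro M ⟨hM, h1, h0⟩ f -
    by_cases hf : Bdd f
    · have := hM.abs_le hf.choose_spec
      rw [h1, mul_one] at this
      simpa [b, hf] using abs_le.1 this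
    · simp [b, hf, h0 f hf]

/-- A continuous linear functional which is positive somewhere on the invariant means is
positive at some extreme invariant mean. -/
lemma exists_extreme_pos (l : ((G → ℝ) → ℝ) →L[ℝ] ℝ) {M : (G → ℝ) → ℝ} (hM : M ∈ invMeans G)
    (hl : 0 < l M) : ∃ ν ∈ (invMeans G).extremePoints ℝ, 0 < l ν := by
  obtain ⟨M₀, hM₀, hmax⟩ := isCompact_invMeans.exists_isMaxOn ⟨M, hM⟩ l.continuous.continuousOn
  have hexp : IsExposed ℝ (invMeans G) (l.toExposed (invMeans G)) :=
    ContinuousLinearMap.toExposed.isExposed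
  obtain ⟨ν, hν⟩ := (hexp.isCompact isCompact_invMeans).extremePoints_nonempty ⟨M₀, hM₀, hmax⟩
  exact ⟨ν, hexp.isExtreme.extremePoints_subset_extremePoints hν, hl.trans_le (hν.1.2 M hM)⟩

/-- An invariant positive functional dominated by an extreme invariant mean is a multiple of it. -/
lemma eq_mul_of_le_extreme {ν : (G → ℝ) → ℝ} (hν : ν ∈ (invMeans G).extremePoints ℝ)
    {N : (G → ℝ) → ℝ} (hN : PosInv N) (hle : ∀ f, Bdd f → (∀ x, 0 ≤ f x) → N f ≤ ν f)
    {f : G → ℝ} (hf : Bdd f) : N f = N (fun _ => 1) * ν f := by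
  classical
  obtain ⟨⟨hν1, hone, hjunk⟩, hext⟩ := hν
  set c := N (fun _ => 1) with hc
  have hc0 : 0 ≤ c := hN.nonneg _ (bdd_const 1) fun _ => zero_le_one
  have hc1 : c ≤ 1 := hone ▸ hle _ (bdd_const 1) fun _ => zero_le_one
  have mem : ∀ s : ℝ, |s| ≤ 1 / 2 →
      (fun f => if Bdd f then ν f + s * (N f - c * ν f) else 0) ∈ invMeans G := by
    intro s hs
    refine ⟨⟨⟨fun f g hf hg => ?_, fun r f hf => ?_, fun f hf h0 => ?_⟩, fun t f hf => ?_⟩, ?_,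
      fun f hf => by simp [hf]⟩
    · simp only [hf, hg, hf.add hg, if_true, hν1.add f g hf hg, hN.add f g hf hg]
      ring
    · simp only [hf, hf.const_mul r, if_true, hν1.const_mul r f hf, hN.const_mul r f hf]
      ring
    · simp only [hf, if_true]
      have h1 := hle f hf h0
      have h2 := hN.nonneg f hf h0
      have h3 := hν1.nonneg f hf h0
      obtain ⟨h4, h5⟩ := abs_le.1 hs
      have h6 : c * ν f ≤ ν f := mul_le_of_le_one_left h3 hc1
      have h7 : 0 ≤ c * ν f := mul_nonneg hc0 h3
      have h8 : |s * (N f - c * ν f)| ≤ 1 / 2 * ν f := by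
        rw [abs_mul]
        exact mul_le_mul hs (abs_le.2 ⟨by linarith, by linarith⟩) (abs_nonneg _) (by norm_num)
      linarith [(abs_le.1 h8).1]
    · simp only [hf, hf.comp, if_true, hν1.shift t f hf, hN.shift t f hf]
    · simp only [bdd_const, if_true, hone, ← hc]
      ring
  have h := hext (mem (1 / 2) (by norm_num [abs_of_pos])) (mem (-(1 / 2)) (by norm_num [abs_of_pos]))
    ⟨1 / 2, 1 / 2, by norm_num, by norm_num, by norm_num, by
      ext f
      by_cases hf : Bdd f
      · simp [hf]; ring
      · simp [hf, hjunk f hf]⟩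
  have h' := congrFun h f
  simp only [hf, if_true] at h'
  linarith

end InvariantMeans

section Ergodic

variable {G : Type*} [AddCommGroup G]

/-- The translate of `P` by `-t`. -/
def sh (t : G) (P : Set G) : Set G := {x | x + t ∈ P}

lemma chi_sh (t : G) (P : Set G) : (fun x => chi P (x + t)) = chi (sh t P) := by
  ext x
  by_cases h : x + t ∈ P
  · rw [chi_of_mem h, chi_of_mem (show x ∈ sh t P from h)]
  · rw [chi_of_notMem h, chi_of_notMem (show x ∉ sh t P from h)]

lemma sh_sh (s t : G) (P : Set G) : sh s (sh t P) = sh (s + t) P := by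
  ext x
  simp [sh, add_assoc]

lemma PosInv.chi_sh {M : (G → ℝ) → ℝ} (hM : PosInv M) (t : G) (P : Set G) :
    M (chi (sh t P)) = M (chi P) := by
  rw [← SumsetMeans.chi_sh, hM.shift t _ (bdd_chi P)]

lemma PosInv.chi_diff_comm {M : (G → ℝ) → ℝ} (hM : PosInv M) {t : G} {P : Set G}
    (h : M (chi (P \ sh t P)) = 0) : M (chi (sh t P \ P)) = 0 := by
  have h1 := hM.chi_inter_add_diff P (sh t P)
  have h2 := hM.chi_inter_add_diff (sh t P) P
  rw [hM.chi_sh, Set.inter_comm] at h2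
  linarith

section Quotient

variable {M : (G → ℝ) → ℝ} (hM : PosInv M) (K : AddSubgroup G)
include hM

lemma PosInv.chi_fiber (q : G ⧸ K) :
    M (chi ((QuotientAddGroup.mk : G → G ⧸ K) ⁻¹' {q})) = M (chi (K : Set G)) := by
  obtain ⟨g, rfl⟩ := QuotientAddGroup.mk_surjective q
  rw [← hM.chi_sh g]
  congr 2
  ext x
  simp only [Set.mem_preimage, Set.mem_singleton_iff, sh, Set.mem_ofPred_eq, SetLike.mem_coe]
  rw [eq_comm, QuotientAddGroup.eq, add_comm, add_neg_cancel_right]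

lemma PosInv.chi_preimage [K.FiniteIndex] (S : Set (G ⧸ K)) :
    M (chi ((QuotientAddGroup.mk : G → G ⧸ K) ⁻¹' S)) = S.ncard * M (chi (K : Set G)) := by
  classical
  have := Fintype.ofFinite (G ⧸ K)
  have h := hM.chi_biUnion S.toFinset (fun q => (QuotientAddGroup.mk : G → G ⧸ K) ⁻¹' {q}) ?_
  · simp only [hM.chi_fiber, Finset.sum_const, nsmul_eq_mul] at h
    rw [Set.ncard_eq_toFinset_card', ← h]
    congr 2
    ext x
    simp
  · intro x _ y _ hxy
    rw [← Set.preimage_inter, Set.singleton_inter_eq_empty.2 (by simpa using hxy),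
      Set.preimage_empty, hM.chi_empty]

lemma PosInv.index_mul_chi [K.FiniteIndex] :
    (K.index : ℝ) * M (chi (K : Set G)) = M (fun _ => 1) := by
  rw [← chi_univ, ← Set.preimage_univ (f := (QuotientAddGroup.mk : G → G ⧸ K)), hM.chi_preimage,
    Set.ncard_univ, AddSubgroup.index]

lemma PosInv.chi_eq_zero_of_cosets [K.FiniteIndex] {S : Set G}
    (h : ∀ x ∈ S, M (chi {y ∈ S | -x + y ∈ K}) = 0) : M (chi S) = 0 := by
  classical
  have := Fintype.ofFinite (G ⧸ K)
  have hS : S = ⋃ q ∈ (Finset.univ : Finset (G ⧸ K)), {y ∈ S | (y : G ⧸ K) = q} := by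
    ext; simp
  rw [hS]
  refine hM.chi_biUnion_eq_zero _ _ fun q _ => ?_
  rcases Set.eq_empty_or_nonempty {y ∈ S | (y : G ⧸ K) = q} with h0 | ⟨x, hx, rfl⟩
  · rw [h0, hM.chi_empty]
  · convert h x hx using 5 with y
    rw [eq_comm, QuotientAddGroup.eq]

end Quotient

lemma PosLin.bdd_corr {b : (G → ℝ) → ℝ} (hb : PosLin b) {f : G → ℝ} (hf : Bdd f) :
    Bdd (fun a => b (fun x => f (x + a))) := by
  obtain ⟨C, hC⟩ := hf
  exact ⟨C * b (fun _ => 1), fun a => hb.abs_le fun x => hC (x + a)⟩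

variable {ν b : (G → ℝ) → ℝ}

/-- Averaging the translates of a functional dominated by an extreme invariant mean gives a
multiple of that mean. -/
lemma average_corr (hν : ν ∈ (invMeans G).extremePoints ℝ) (hb : PosLin b)
    (hle : ∀ f, Bdd f → (∀ x, 0 ≤ f x) → b f ≤ ν f) {f : G → ℝ} (hf : Bdd f) :
    ν (fun a => b (fun x => f (x + a))) = b (fun _ => 1) * ν f := by
  have hν' := hν.1.1
  have hN : PosInv fun f => ν (fun a => b (fun x => f (x + a))) := by
    refine ⟨⟨fun f g hf hg => ?_, fun c f hf => ?_, fun f hf h0 => ?_⟩, fun t f hf => ?_⟩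
    · rw [← hν'.add _ _ (hb.bdd_corr hf) (hb.bdd_corr hg)]
      congr 1; ext a; exact hb.add _ _ (hf.comp _) (hg.comp _)
    · rw [← hν'.const_mul _ _ (hb.bdd_corr hf)]
      congr 1; ext a; exact hb.const_mul _ _ (hf.comp _)
    · exact hν'.nonneg _ (hb.bdd_corr hf) fun a => hb.nonneg _ (hf.comp _) fun x => h0 _
    · rw [← hν'.shift t _ (hb.bdd_corr hf)]
      simp only [add_assoc]
  have h := eq_mul_of_le_extreme hν hN (fun f hf h0 => ?_) hf
  · rw [h]
    congr 1
    rw [hν'.const, hν.1.2.1, mul_one]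
  · have h1 : ν (fun _ : G => ν f) = ν f := by rw [hν'.const, hν.1.2.1, mul_one]
    rw [← h1]
    refine hν'.mono (hb.bdd_corr hf) (bdd_const _) fun a => ?_
    rw [← hν'.shift a f hf]
    exact hle _ (hf.comp _) fun x => h0 _

/-- The average over `a ∈ P` of the `b`-measure of `Q - a`. -/
noncomputable def corr (ν b : (G → ℝ) → ℝ) (P Q : Set G) : ℝ :=
  ν (fun a => chi P a * b (chi (sh a Q)))

section Corr

variable (hν : ν ∈ (invMeans G).extremePoints ℝ) (hb : PosLin b)
  (hle : ∀ f, Bdd f → (∀ x, 0 ≤ f x) → b f ≤ ν f)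
include hν hb

omit hν in
lemma bdd_b_sh (Q : Set G) : Bdd (fun a => b (chi (sh a Q))) := by
  simpa only [chi_sh] using hb.bdd_corr (bdd_chi Q)

lemma corr_compl_right (P Q : Set G) :
    corr ν b P Qᶜ = ν (chi P) * b (fun _ => 1) - corr ν b P Q := by
  have hν' := hν.1.1
  rw [corr, corr, mul_comm, ← hν'.const_mul _ _ (bdd_chi P),
    ← hν'.sub ((bdd_chi P).const_mul _) ((bdd_chi P).mul (bdd_b_sh hb Q))]
  congr 1; ext a
  rw [show sh a Qᶜ = (sh a Q)ᶜ from rfl, hb.chi_compl]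
  ring

include hle in
lemma corr_compl_left (P Q : Set G) :
    corr ν b Pᶜ Q = b (fun _ => 1) * ν (chi Q) - corr ν b P Q := by
  have hν' := hν.1.1
  have h := average_corr hν hb hle (bdd_chi Q)
  simp only [chi_sh] at h
  rw [← h, corr, corr, ← hν'.sub (bdd_b_sh hb Q) ((bdd_chi P).mul (bdd_b_sh hb Q))]
  congr 1; ext a
  rw [chi_compl]
  ring

lemma corr_nonneg (P Q : Set G) : 0 ≤ corr ν b P Q :=
  hν.1.1.nonneg _ ((bdd_chi P).mul (bdd_b_sh hb Q)) fun _ =>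
    mul_nonneg (chi_nonneg _ _) (hb.chi_nonneg _)

lemma corr_mono {P P' Q Q' : Set G} (hP : P ⊆ P') (hQ : Q ⊆ Q') :
    corr ν b P Q ≤ corr ν b P' Q' :=
  hν.1.1.mono ((bdd_chi P).mul (bdd_b_sh hb Q)) ((bdd_chi P').mul (bdd_b_sh hb Q')) fun a =>
    mul_le_mul (chi_mono hP a) (hb.chi_mono fun _ hx => hQ hx) (hb.chi_nonneg _) (chi_nonneg _ _)

lemma corr_union_right_le (P Q Q' : Set G) :
    corr ν b P (Q ∪ Q') ≤ corr ν b P Q + corr ν b P Q' := by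
  have hν' := hν.1.1
  have h1 := (bdd_chi P).mul (bdd_b_sh hb Q)
  have h2 := (bdd_chi P).mul (bdd_b_sh hb Q')
  rw [corr, corr, corr, ← hν'.add _ _ h1 h2]
  refine hν'.mono ((bdd_chi P).mul (bdd_b_sh hb _)) (h1.add h2) fun a => ?_
  rw [← mul_add]
  exact mul_le_mul_of_nonneg_left (hb.chi_union_le (sh a Q) (sh a Q')) (chi_nonneg _ _)

lemma corr_sh (t : G) (P Q : Set G) : corr ν b (sh t P) (sh t Q) = corr ν b P Q := by
  rw [corr, corr, ← hν.1.1.shift t _ ((bdd_chi P).mul (bdd_b_sh hb Q))]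
  congr 1; ext a
  rw [sh_sh, ← congrFun (chi_sh t P) a]

/-- The sets `P` for which almost every translate of `b` lives on `P` or on its complement. -/
def Good (ν b : (G → ℝ) → ℝ) (P : Set G) : Prop := corr ν b P Pᶜ = 0

include hle in
lemma Good.compl {P : Set G} (h : Good ν b P) : Good ν b Pᶜ := by
  have h1 := corr_compl_right hν hb P P
  have h2 := corr_compl_left hν hb hle P P
  unfold Good at *
  rw [compl_compl]
  linarith

lemma Good.inter {P Q : Set G} (hP : Good ν b P) (hQ : Good ν b Q) : Good ν b (P ∩ Q) := by
  refine le_antisymm ?_ (corr_nonneg hν hb _ _)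
  rw [Set.compl_inter]
  refine (corr_union_right_le hν hb _ _ _).trans ?_
  unfold Good at *
  linarith [corr_mono hν hb (Set.inter_subset_left : P ∩ Q ⊆ P) (subset_refl Pᶜ),
    corr_mono hν hb (Set.inter_subset_right : P ∩ Q ⊆ Q) (subset_refl Qᶜ)]

include hle in
lemma Good.diff {P Q : Set G} (hP : Good ν b P) (hQ : Good ν b Q) : Good ν b (P \ Q) :=
  hP.inter hν hb (hQ.compl hν hb hle)

lemma Good.sh {P : Set G} (hP : Good ν b P) (t : G) : Good ν b (sh t P) :=
  (corr_sh hν hb t P Pᶜ).trans hP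

include hle in
lemma Good.le_measure {P : Set G} (hP : Good ν b P) (h0 : 0 < ν (chi P)) :
    b (fun _ => 1) ≤ ν (chi P) := by
  have hν' := hν.1.1
  have h1 := corr_compl_right hν hb P P
  rw [hP] at h1
  have h2 : corr ν b P P ≤ ν (chi P) * ν (chi P) := by
    rw [← hν'.const_mul _ _ (bdd_chi P)]
    refine hν'.mono ((bdd_chi P).mul (bdd_b_sh hb P)) ((bdd_chi P).const_mul _) fun a => ?_
    rw [mul_comm]
    refine mul_le_mul_of_nonneg_right ?_ (chi_nonneg _ _)
    rw [← hν'.chi_sh a]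
    exact hle _ (bdd_chi _) (chi_nonneg _)
  nlinarith

include hle in
lemma exists_atom (hβ : 0 < b (fun _ => 1)) : ∃ P : Set G, Good ν b P ∧ 0 < ν (chi P) ∧
    ∀ Q, Good ν b Q → ν (chi (P ∩ Q)) = 0 ∨ ν (chi (P \ Q)) = 0 := by
  have hν' := hν.1.1
  set V := {v : ℝ | ∃ P, Good ν b P ∧ 0 < ν (chi P) ∧ ν (chi P) = v} with hV
  have hne : V.Nonempty := by
    refine ⟨_, Set.univ, ?_, ?_, rfl⟩
    · simp [Good, corr, SumsetMeans.sh, hb.chi_empty, hν'.zero]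
    · rw [chi_univ, hν.1.2.1]; exact one_pos
  have hbdd : BddBelow V := ⟨0, by rintro _ ⟨P, _, h, rfl⟩; exact h.le⟩
  obtain ⟨_, ⟨P, hP, h0, rfl⟩, hlt⟩ := exists_lt_of_csInf_lt hne (lt_add_of_pos_right (sInf V) hβ)
  refine ⟨P, hP, h0, fun Q hQ => ?_⟩
  by_contra! h
  have h1 := (hν'.chi_nonneg (P ∩ Q)).lt_of_ne' h.1
  have h2 := (hν'.chi_nonneg (P \ Q)).lt_of_ne' h.2
  have h3 := csInf_le hbdd ⟨_, hP.inter hν hb hQ, h1, rfl⟩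
  have h4 := (hP.diff hν hb hle hQ).le_measure hν hb hle h2
  linarith [hν'.chi_inter_add_diff P Q]

end Corr

/-- The almost-everywhere stabilizer of a set. -/
def aeStab {M : (G → ℝ) → ℝ} (hM : PosInv M) (P : Set G) : AddSubgroup G where
  carrier := {h | M (chi (P \ sh h P)) = 0}
  zero_mem' := by simp [sh, hM.chi_empty]
  add_mem' := by
    intro a c ha hc
    refine hM.chi_eq_zero_of_subset (T := (P \ sh c P) ∪ sh c (P \ sh a P)) ?_
      (hM.chi_union_eq_zero hc (by rw [hM.chi_sh]; exact ha))
    rintro x ⟨hx, hx'⟩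
    by_cases h : x + c ∈ P
    · exact Or.inr ⟨h, fun h' => hx' (by
        have : x + c + a ∈ P := h'
        rwa [add_assoc, add_comm c a] at this)⟩
    · exact Or.inl ⟨hx, h⟩
  neg_mem' := by
    intro h hh
    show M _ = 0
    rw [← hM.chi_sh h]
    convert hM.chi_diff_comm hh using 3
    ext x
    simp [sh]

lemma finiteIndex_aeStab {M : (G → ℝ) → ℝ} (hM : PosInv M) (hone : M (fun _ => 1) = 1) {P : Set G}
    (h0 : 0 < M (chi P))
    (hP : ∀ t, M (chi (P ∩ sh t P)) = 0 ∨ M (chi (P \ sh t P)) = 0) :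
    (aeStab hM P).FiniteIndex ∧ M (chi P) ≤ M (chi (aeStab hM P : Set G)) := by
  classical
  set H := aeStab hM P
  have hcard : ∀ s : Finset (G ⧸ H), s.card * M (chi P) ≤ 1 := by
    intro s
    have h := hM.chi_biUnion s (fun q => sh q.out P) ?_
    · simp only [hM.chi_sh, Finset.sum_const, nsmul_eq_mul] at h
      rw [← h, ← hone, ← chi_univ]
      exact hM.chi_mono (Set.subset_univ _)
    · intro x _ y _ hxy
      have : sh x.out P ∩ sh y.out P = sh x.out (P ∩ sh (-x.out + y.out) P) := by
        ext z
        simp [sh]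
      rw [this, hM.chi_sh]
      refine (hP _).resolve_right fun h => hxy ?_
      have h' : -x.out + y.out ∈ H := h
      rwa [← QuotientAddGroup.eq, QuotientAddGroup.out_eq', QuotientAddGroup.out_eq'] at h'
  have hfin : Finite (G ⧸ H) := by
    by_contra hinf
    rw [not_finite_iff_infinite] at hinf
    obtain ⟨n, hn⟩ := exists_nat_gt (1 / M (chi P))
    obtain ⟨s, hs⟩ := Infinite.exists_subset_card_eq (G ⧸ H) n
    have := hcard s
    rw [div_lt_iff₀ h0] at hn
    rw [hs] at this
    linarith
  have hH : H.FiniteIndex := AddSubgroup.finiteIndex_of_finite_quotient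
  refine ⟨hH, ?_⟩
  have := Fintype.ofFinite (G ⧸ H)
  have h1 := hcard Finset.univ
  rw [Finset.card_univ, ← Nat.card_eq_fintype_card, ← AddSubgroup.index, ← hone,
    ← hM.index_mul_chi H] at h1
  exact le_of_mul_le_mul_left h1 (by exact_mod_cast Nat.pos_of_ne_zero hH.index_ne_zero)

/-- If every translate `b + a` with `a ∈ A` lives on `A`, then `A` is almost periodic with respect
to a subgroup whose density is at least the mass of `b`. -/
lemma exists_period (hν : ν ∈ (invMeans G).extremePoints ℝ) (hb : PosLin b)
    (hle : ∀ f, Bdd f → (∀ x, 0 ≤ f x) → b f ≤ ν f) (hβ : 0 < b (fun _ => 1)) {A : Set G}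
    (hA : ∀ a ∈ A, b (chi (sh a Aᶜ)) = 0) :
    ∃ H : AddSubgroup G, H.FiniteIndex ∧ b (fun _ => 1) ≤ ν (chi (H : Set G)) ∧
      ν (chi ((A + (H : Set G)) \ A)) = 0 := by
  have hν' := hν.1.1
  have hgood : Good ν b A := by
    rw [Good, corr, ← hν'.zero]
    congr 1; ext a
    by_cases ha : a ∈ A
    · rw [hA a ha, mul_zero]
    · rw [chi_of_notMem ha, zero_mul]
  obtain ⟨P, hP, h0, hatom⟩ := exists_atom hν hb hle hβ
  obtain ⟨hfin, hPH⟩ := finiteIndex_aeStab hν' hν.1.2.1 h0 fun t => hatom _ (hP.sh hν hb t)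
  set H := aeStab hν' P with hH
  have hinv : ∀ h ∈ H, ν (chi (A \ sh h A)) = 0 := by
    intro h hh
    set U := A \ sh h A with hU
    by_contra hne
    have hgU : Good ν b U := hgood.diff hν hb hle (hgood.sh hν hb h)
    have herg := average_corr hν (b := fun f => ν (fun x => chi P x * f x)) ?_ ?_ (bdd_chi U)
    rotate_left
    · refine ⟨fun f g hf hg => ?_, fun c f hf => ?_, fun f hf h0 => ?_⟩
      · rw [← hν'.add _ _ ((bdd_chi P).mul hf) ((bdd_chi P).mul hg)]
        simp only [mul_add]
      · rw [← hν'.const_mul _ _ ((bdd_chi P).mul hf)]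
        simp only [mul_left_comm]
      · exact hν'.nonneg _ ((bdd_chi P).mul hf) fun x => mul_nonneg (chi_nonneg _ _) (h0 x)
    · exact fun f hf h0 => hν'.mono ((bdd_chi P).mul hf) hf fun x =>
        mul_le_of_le_one_left (h0 x) (chi_le_one _ _)
    have hex : ∃ a, ν (chi (P ∩ sh a U)) ≠ 0 := by
      by_contra! hall
      have : (fun a => ν (fun x => chi P x * chi U (x + a))) = fun _ => 0 := by
        ext a
        rw [← hall a]
        congr 1; ext x
        rw [chi_inter, ← congrFun (chi_sh a U) x]
      simp only [this, hν'.zero, mul_one] at herg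
      rcases mul_eq_zero.1 herg.symm with h | h
      · exact h0.ne' h
      · exact hne h
    obtain ⟨a, ha⟩ := hex
    have h1 := (hatom _ (hgU.sh hν hb a)).resolve_left ha
    refine h0.ne' (hν'.chi_eq_zero_of_subset
      (T := (P \ sh a U) ∪ ((P \ sh h P) ∪ sh h (P \ sh a U))) ?_
      (hν'.chi_union_eq_zero h1 (hν'.chi_union_eq_zero hh (by rwa [hν'.chi_sh]))))
    intro x hx
    by_contra hcon
    simp only [Set.mem_union, not_or, Set.mem_sdiff, not_and, not_not, sh, Set.mem_ofPred_eq] at hcon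
    obtain ⟨c1, c2, c3⟩ := hcon
    have d1 : x + a ∈ U := c1 hx
    have d2 : x + h + a ∈ U := c3 (c2 hx)
    exact d1.2 (by
      show x + a + h ∈ A
      rw [add_right_comm]; exact d2.1)
  refine ⟨H, hfin, (hP.le_measure hν hb hle h0).trans hPH, hν'.chi_eq_zero_of_cosets H ?_⟩
  rintro _ ⟨⟨a, ha, h, hh, rfl⟩, -⟩
  have hlive : ∀ k ∈ H, b (fun _ => 1) ≤ b (chi (sh (a + k) A)) := by
    intro k hk
    have h1 := hb.chi_compl (sh a A)
    rw [show (sh a A)ᶜ = sh a Aᶜ from rfl, hA a ha] at h1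
    have h2 : b (chi (sh a A \ sh (a + k) A)) = 0 := by
      refine le_antisymm ((hle _ (bdd_chi _) (chi_nonneg _)).trans ?_) (hb.chi_nonneg _)
      rw [← hinv k hk, ← hν'.chi_sh a (A \ sh k A)]
      refine hν'.chi_mono fun x hx => ⟨hx.1, fun hx' => hx.2 ?_⟩
      have : x + a + k ∈ A := hx'
      rwa [add_assoc] at this
    linarith [hb.chi_le_of_diff_eq_zero h2]
  have hzero : corr ν b Aᶜ A = 0 := by
    simpa [Good] using hgood.compl hν hb hle
  set S := {y ∈ (A + (H : Set G)) \ A | -(a + h) + y ∈ H} with hS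
  have h3 : b (fun _ => 1) * ν (chi S) ≤ corr ν b Aᶜ A := by
    rw [← hν'.const_mul _ _ (bdd_chi S)]
    refine hν'.mono ((bdd_chi S).const_mul _) ((bdd_chi _).mul (bdd_b_sh hb A)) fun y => ?_
    by_cases hy : y ∈ S
    · rw [chi_of_mem hy, chi_of_mem (show y ∈ Aᶜ from hy.1.2), mul_one, one_mul]
      have := hlive _ (H.add_mem hh hy.2)
      rwa [show a + (h + (-(a + h) + y)) = y by abel] at this
    · rw [chi_of_notMem hy, mul_zero]
      exact mul_nonneg (chi_nonneg _ _) (hb.chi_nonneg _)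
  exact le_antisymm (nonpos_of_mul_nonpos_right (h3.trans hzero.le) hβ) (hν'.chi_nonneg _)

end Ergodic

section DysonTransform

variable {G : Type*} [AddCommGroup G]

/-- A nearly optimal Dyson transform of the pair `(A, B)`. -/
lemma exists_dyson_step {M : (G → ℝ) → ℝ} (hM : PosInv M) {A B C : Set G} (hAB : A + B ⊆ C)
    (hB : 0 ∈ B) (hA : A.Nonempty) {ε : ℝ} (hε : 0 < ε) :
    ∃ A' B' : Set G, A ⊆ A' ∧ B' ⊆ B ∧ A' + B' ⊆ C ∧ 0 ∈ B' ∧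
      M (chi A') + M (chi B') = M (chi A) + M (chi B) ∧
      ∀ e ∈ A, M (chi (sh (-e) B \ A)) ≤ M (chi A') - M (chi A) + ε := by
  set V := (fun e => M (chi (sh (-e) B \ A))) '' A with hV
  have hbdd : BddAbove V := by
    refine ⟨M (fun _ => 1), ?_⟩
    rintro _ ⟨e, -, rfl⟩
    rw [← chi_univ]
    exact hM.chi_mono (Set.subset_univ _)
  obtain ⟨_, ⟨e, he, rfl⟩, hlt⟩ := exists_lt_of_lt_csSup (hA.image _) (sub_lt_self (sSup V) hε)
  refine ⟨A ∪ sh (-e) B, B ∩ sh e A, Set.subset_union_left, Set.inter_subset_left, ?_,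
    ⟨hB, by simpa [sh] using he⟩, ?_, fun e' he' => ?_⟩
  · rintro _ ⟨x, hx, y, ⟨hy, hy'⟩, rfl⟩
    rcases hx with hx | hx
    · exact hAB (Set.add_mem_add hx hy)
    · have h := hAB (Set.add_mem_add (show y + e ∈ A from hy') (show x + -e ∈ B from hx))
      rwa [show y + e + (x + -e) = x + y by abel] at h
  · have h1 := hM.chi_union_add_inter A (sh (-e) B)
    rw [hM.chi_sh, ← hM.chi_sh e (A ∩ sh (-e) B)] at h1
    rw [← h1]
    congr 3
    ext x
    simp [sh, and_comm]
  · have h1 := le_csSup hbdd (Set.mem_image_of_mem (fun e => M (chi (sh (-e) B \ A))) he')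
    have h2 := hM.chi_union (S := A) (T := sh (-e) B \ A) Set.disjoint_sdiff_right
    rw [Set.union_sdiff_self] at h2
    simp only at h1 hlt
    linarith

/-- Iterating Dyson transforms with vanishing losses. -/
lemma exists_dyson_sequence {M : (G → ℝ) → ℝ} (hM : PosInv M) {A B C : Set G} (hAB : A + B ⊆ C)
    (hB : 0 ∈ B) (hA : A.Nonempty) :
    ∃ S T : ℕ → Set G, S 0 = A ∧ Monotone S ∧ Antitone T ∧ (∀ n, S n ⊆ C) ∧
      (∀ n, M (chi (S n)) + M (chi (T n)) = M (chi A) + M (chi B)) ∧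
      ∀ n, ∀ e ∈ S n, M (chi (sh (-e) (T n) \ S n)) ≤
        M (chi (S (n + 1))) - M (chi (S n)) + 1 / ((n : ℝ) + 1) := by
  let X := {p : Set G × Set G // p.1 + p.2 ⊆ C ∧ 0 ∈ p.2 ∧ p.1.Nonempty ∧
    M (chi p.1) + M (chi p.2) = M (chi A) + M (chi B)}
  have step : ∀ (n : ℕ) (p : X), ∃ q : X, p.1.1 ⊆ q.1.1 ∧ q.1.2 ⊆ p.1.2 ∧
      ∀ e ∈ p.1.1, M (chi (sh (-e) p.1.2 \ p.1.1)) ≤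
        M (chi q.1.1) - M (chi p.1.1) + 1 / ((n : ℝ) + 1) := by
    rintro n ⟨p, h1, h2, h3, h4⟩
    obtain ⟨A', B', k1, k2, k3, k4, k5, k6⟩ :=
      exists_dyson_step hM h1 h2 h3 (Nat.one_div_pos_of_nat (α := ℝ) (n := n))
    exact ⟨⟨(A', B'), k3, k4, h3.mono k1, k5.trans h4⟩, k1, k2, k6⟩
  choose next hnext using step
  let p : ℕ → X := fun n => Nat.rec ⟨(A, B), hAB, hB, hA, rfl⟩ next n
  refine ⟨fun n => (p n).1.1, fun n => (p n).1.2, rfl,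
    monotone_nat_of_le_succ fun n => (hnext n (p n)).1,
    antitone_nat_of_succ_le fun n => (hnext n (p n)).2.1,
    fun n x hx => ?_, fun n => (p n).2.2.2.2, fun n => (hnext n (p n)).2.2⟩
  simpa using (p n).2.1 (Set.add_mem_add hx (p n).2.2.1)

variable {ν : (G → ℝ) → ℝ}

lemma exists_periodic_subset_of_zero_mem (hν : ν ∈ (invMeans G).extremePoints ℝ) {A B C : Set G}
    (hAB : A + B ⊆ C) (hB : 0 ∈ B) (hlt : ν (chi C) < ν (chi A) + ν (chi B)) {c : G}
    (hc : c ∈ A) :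
    ∃ (D : Set G) (H : AddSubgroup G), H.FiniteIndex ∧ c ∈ D ∧ D + (H : Set G) = D ∧
      ν (chi (D \ C)) = 0 ∧ ν (chi A) + ν (chi B) ≤ ν (chi D) + ν (chi (H : Set G)) := by
  have hν' := hν.1.1
  obtain ⟨S, T, hS0, hS, hT, hSC, hsum, hgain⟩ := exists_dyson_sequence hν' hAB hB ⟨c, hc⟩
  obtain ⟨b, hb, hlim⟩ := hν'.exists_restrict T hT
  set A' := ⋃ n, S n with hA'
  have hconv := tendsto_atTop_ciSup (f := fun n => ν (chi (S n)))
    (fun m n h => hν'.chi_mono (hS h)) ⟨ν (chi C), by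
      rintro _ ⟨n, rfl⟩; exact hν'.chi_mono (hSC n)⟩
  have hloss : Tendsto (fun n : ℕ => ν (chi (S (n + 1))) - ν (chi (S n)) + 1 / ((n : ℝ) + 1))
      atTop (nhds 0) := by
    simpa using (((tendsto_add_atTop_iff_nat 1).2 hconv).sub hconv).add
      tendsto_one_div_add_atTop_nhds_zero_nat
  have hlive : ∀ a ∈ A', b (chi (sh a A'ᶜ)) = 0 := by
    intro a ha
    obtain ⟨N, hN⟩ := Set.mem_iUnion.1 ha
    refine le_antisymm (le_of_tendsto_of_tendsto (hlim _ (bdd_chi _)) hloss ?_) (hb.chi_nonneg _)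
    filter_upwards [eventually_ge_atTop N] with n hn
    refine le_trans (le_of_eq ?_) ((hν'.chi_mono (S := sh (-a) (T n) \ A') ?_).trans
      (hgain n a (hS hn hN)))
    · rw [← hν'.chi_sh a (sh (-a) (T n) \ A')]
      congr 1; ext x
      rw [← chi_inter]
      congr 1; ext x
      simp [sh, and_comm]
    · exact Set.sdiff_subset_sdiff_right (Set.subset_iUnion S n)
  have hle : ∀ f, Bdd f → (∀ x, 0 ≤ f x) → b f ≤ ν f := fun f hf h0 =>
    le_of_tendsto' (hlim f hf) fun n => hν'.mono (hf.mul (bdd_chi _)) hf fun x =>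
      mul_le_of_le_one_right (h0 x) (chi_le_one _ _)
  have hA'C : A' ⊆ C := Set.iUnion_subset hSC
  have hmass : ν (chi A) + ν (chi B) ≤ ν (chi A') + b (fun _ => 1) := by
    refine ge_of_tendsto' ((hlim _ (bdd_const 1)).const_add _) fun n => ?_
    simp only [one_mul]
    rw [← hsum n]
    exact add_le_add_left (hν'.chi_mono (Set.subset_iUnion S n)) _
  have hβ : 0 < b (fun _ => 1) := by linarith [hν'.chi_mono hA'C]
  obtain ⟨H, hH, hbH, hnull⟩ := exists_period hν hb hle hβ hlive
  have hsub : A' ⊆ A' + (H : Set G) := fun x hx => ⟨x, hx, 0, H.zero_mem, add_zero x⟩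
  refine ⟨A' + H, H, hH, hsub (Set.mem_iUnion.2 ⟨0, hS0 ▸ hc⟩), ?_,
    hν'.chi_eq_zero_of_subset (Set.sdiff_subset_sdiff_right hA'C) hnull, ?_⟩
  · rw [add_assoc, coe_add_coe]
  · linarith [hν'.chi_mono hsub]

/-- Every element of `A + B` lies in a periodic set which is almost contained in `A + B` and
satisfies Kneser's inequality. -/
lemma exists_periodic_subset (hν : ν ∈ (invMeans G).extremePoints ℝ) {A B : Set G}
    (hlt : ν (chi (A + B)) < ν (chi A) + ν (chi B)) {c : G} (hc : c ∈ A + B) :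
    ∃ (D : Set G) (H : AddSubgroup G), H.FiniteIndex ∧ c ∈ D ∧ D + (H : Set G) = D ∧
      ν (chi (D \ (A + B))) = 0 ∧
      ν (chi A) + ν (chi B) ≤ ν (chi D) + ν (chi (H : Set G)) := by
  obtain ⟨a, ha, b, hb, rfl⟩ := hc
  have hν' := hν.1.1
  have h := exists_periodic_subset_of_zero_mem hν (A := sh (-b) A) (B := sh b B) (C := A + B)
    ?_ (by simpa [sh] using hb) (by rwa [hν'.chi_sh, hν'.chi_sh]) (c := a + b)
    (by simpa [sh] using ha)
  · rwa [hν'.chi_sh, hν'.chi_sh] at h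
  · rintro _ ⟨x, hx, y, hy, rfl⟩
    exact ⟨x + -b, hx, y + b, hy, by simp only; abel⟩

end DysonTransform

section KneserUnion

section Finite

variable {Q : Type*} [AddCommGroup Q] [Finite Q] {H₁ H₂ : AddSubgroup Q} {C D : Set Q}

lemma ncard_mul_ncard_le_ncard_diff (hH : H₁ ⊓ H₂ = ⊥) (hC : C + (H₁ : Set Q) = C)
    (hD : D + (H₂ : Set Q) = D) (c : Q) :
    {y : H₂ | c + y ∈ C}.ncard * {x : H₁ | c + x ∈ D}ᶜ.ncard ≤ (C \ D).ncard := by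
  rw [← Set.ncard_prod]
  refine Set.ncard_le_ncard_of_injOn (fun p => c + p.2 + p.1) ?_ ?_ (Set.toFinite _)
  · rintro ⟨y, x⟩ ⟨hy, hx⟩
    refine ⟨?_, fun h => hx ?_⟩
    · rw [← hC]
      exact ⟨c + y, hy, x, x.2, by simp only; abel⟩
    · rw [Set.mem_ofPred_eq, ← hD]
      exact ⟨c + x + y, h, -y, neg_mem y.2, by simp only; abel⟩
  · rintro ⟨y, x⟩ - ⟨y', x'⟩ - h
    have h1 : (x : Q) - x' = y' - y := by
      simp only at h
      rw [sub_eq_sub_iff_add_eq_add, add_comm (y' : Q)]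
      exact add_left_cancel (a := c) (by rw [← add_assoc, ← add_assoc]; exact h)
    have h2 : (x : Q) - x' ∈ H₁ ⊓ H₂ := ⟨H₁.sub_mem x.2 x'.2, h1 ▸ H₂.sub_mem y'.2 y.2⟩
    rw [hH, AddSubgroup.mem_bot] at h2
    rw [h2] at h1
    exact Prod.ext (Subtype.ext (sub_eq_zero.1 h1.symm).symm) (Subtype.ext (sub_eq_zero.1 h2))

lemma card_add_two_le (hH : H₁ ⊓ H₂ = ⊥) (hC : C + (H₁ : Set Q) = C)
    (hD : D + (H₂ : Set Q) = D) (h : (C \ D).Nonempty) (h₁ : (D \ C).ncard + 2 ≤ Nat.card H₁)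
    (h₂ : (C \ D).ncard + 2 ≤ Nat.card H₂) : Nat.card H₁ + 2 ≤ Nat.card H₂ := by
  obtain ⟨c, hc, hc'⟩ := h
  have k1 := ncard_mul_ncard_le_ncard_diff hH hC hD c
  have k2 := ncard_mul_ncard_le_ncard_diff (inf_comm H₁ H₂ ▸ hH) hD hC c
  have e1 := Set.ncard_add_ncard_compl {x : H₁ | c + x ∈ D}
  have e2 := Set.ncard_add_ncard_compl {y : H₂ | c + y ∈ C}
  have u1 : 0 < {y : H₂ | c + y ∈ C}.ncard :=
    (Set.ncard_pos (Set.toFinite _)).2 ⟨0, by simpa using hc⟩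
  have w1 : 0 < {x : H₁ | c + x ∈ D}ᶜ.ncard :=
    (Set.ncard_pos (Set.toFinite _)).2 ⟨0, by simpa using hc'⟩
  generalize {y : H₂ | c + y ∈ C}.ncard = u at *
  generalize {y : H₂ | c + y ∈ C}ᶜ.ncard = u' at *
  generalize {x : H₁ | c + x ∈ D}ᶜ.ncard = w' at *
  generalize {x : H₁ | c + x ∈ D}.ncard = w at *
  rcases Nat.eq_zero_or_pos w with rfl | hw
  · nlinarith
  · rcases Nat.eq_zero_or_pos u' with rfl | hu
    · nlinarith
    · exfalso
      zify at *
      nlinarith [mul_nonneg (sub_nonneg.2 (Int.add_one_le_iff.2 u1))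
        (sub_nonneg.2 (Int.add_one_le_iff.2 w1)), mul_nonneg (sub_nonneg.2 (Int.add_one_le_iff.2 hw))
        (sub_nonneg.2 (Int.add_one_le_iff.2 hu))]

/-- Kneser's union inequality for subgroups with trivial intersection. -/
lemma le_ncard_union_add_one (hH : H₁ ⊓ H₂ = ⊥) (hC : C + (H₁ : Set Q) = C)
    (hD : D + (H₂ : Set Q) = D) (h : (C \ D).Nonempty) (h' : (D \ C).Nonempty) :
    C.ncard + Nat.card H₁ ≤ (C ∪ D).ncard + 1 ∨ D.ncard + Nat.card H₂ ≤ (C ∪ D).ncard + 1 := by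
  by_contra! hlt
  have e1 := Set.ncard_sdiff_add_ncard C D (Set.toFinite _) (Set.toFinite _)
  have e2 := Set.ncard_sdiff_add_ncard D C (Set.toFinite _) (Set.toFinite _)
  rw [Set.union_comm] at e2
  have k1 := card_add_two_le hH hC hD h (by lia) (by lia)
  have k2 := card_add_two_le (inf_comm H₁ H₂ ▸ hH) hD hC h' (by lia) (by lia)
  lia

end Finite

variable {G : Type*} [AddCommGroup G] {H₁ H₂ : AddSubgroup G} {C D : Set G}

lemma mem_add_of_period {H : AddSubgroup G} (hC : C + (H : Set G) = C) {x h : G} (hx : x ∈ C)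
    (hh : h ∈ H) : x + h ∈ C := hC ▸ Set.add_mem_add hx hh

lemma period_of_mem {H : AddSubgroup G} (h : ∀ x ∈ C, ∀ h ∈ H, x + h ∈ C) :
    C + (H : Set G) = C := by
  refine Set.Subset.antisymm ?_ fun x hx => ⟨x, hx, 0, H.zero_mem, add_zero x⟩
  rintro _ ⟨x, hx, y, hy, rfl⟩
  exact h x hx y hy

lemma period_mono {H K : AddSubgroup G} (hC : C + (H : Set G) = C) (hK : K ≤ H) :
    C + (K : Set G) = C :=
  period_of_mem fun _ hx _ hh => mem_add_of_period hC hx (hK hh)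

lemma preimage_image_mk {H : AddSubgroup G} (hC : C + (H : Set G) = C) :
    (QuotientAddGroup.mk : G → G ⧸ H) ⁻¹' (QuotientAddGroup.mk '' C) = C := by
  refine Set.Subset.antisymm ?_ (Set.subset_preimage_image _ _)
  rintro x ⟨y, hy, hxy⟩
  rw [QuotientAddGroup.eq] at hxy
  simpa using mem_add_of_period hC hy hxy

lemma ncard_image_mk_mul {M : (G → ℝ) → ℝ} (hM : PosInv M) {H : AddSubgroup G} [H.FiniteIndex]
    (hC : C + (H : Set G) = C) :
    M (chi C) = ((QuotientAddGroup.mk : G → G ⧸ H) '' C).ncard * M (chi (H : Set G)) := by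
  rw [← hM.chi_preimage, preimage_image_mk hC]

/-- Kneser's union inequality for periodic sets. -/
lemma PosInv.chi_union_periodic {M : (G → ℝ) → ℝ} (hM : PosInv M) [H₁.FiniteIndex]
    [H₂.FiniteIndex] (hC : C + (H₁ : Set G) = C) (hD : D + (H₂ : Set G) = D)
    (h : (C \ D).Nonempty) (h' : (D \ C).Nonempty) :
    M (chi C) + M (chi (H₁ : Set G)) ≤ M (chi (C ∪ D)) + M (chi ((H₁ ⊓ H₂ : AddSubgroup G) : Set G)) ∨
    M (chi D) + M (chi (H₂ : Set G)) ≤ M (chi (C ∪ D)) + M (chi ((H₁ ⊓ H₂ : AddSubgroup G) : Set G)) := by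
  set H := H₁ ⊓ H₂ with hHdef
  have p1 := period_mono hC (inf_le_left : H ≤ H₁)
  have p2 := period_mono hD (inf_le_right : H ≤ H₂)
  have p3 : (C ∪ D) + (H : Set G) = C ∪ D := by rw [Set.union_add, p1, p2]
  have self : ∀ K : AddSubgroup G, (K : Set G) + (K : Set G) = K := fun K => coe_add_coe K
  have q1 : (H₁ : Set G) + (H : Set G) = H₁ := period_mono (self _) inf_le_left
  have q2 : (H₂ : Set G) + (H : Set G) = H₂ := period_mono (self _) inf_le_right
  let π := QuotientAddGroup.mk' H
  have key := le_ncard_union_add_one (H₁ := H₁.map π) (H₂ := H₂.map π) (C := π '' C) (D := π '' D)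
    ?_ ?_ ?_ ?_ ?_
  · have c0 := hM.chi_nonneg (H : Set G)
    rw [ncard_image_mk_mul hM p1, ncard_image_mk_mul hM p2, ncard_image_mk_mul hM p3,
      ncard_image_mk_mul hM q1, ncard_image_mk_mul hM q2]
    rw [← Set.image_union] at key
    have e : ∀ K : AddSubgroup G, Nat.card (K.map π) = (π '' (K : Set G)).ncard := fun K => by
      rw [← Nat.card_coe_set_eq]; rfl
    rw [e, e] at key
    refine key.imp (fun k => ?_) fun k => ?_ <;>
    · rw [← add_mul, ← add_one_mul]
      exact mul_le_mul_of_nonneg_right (by exact_mod_cast k) c0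
  · rw [eq_bot_iff]
    rintro _ ⟨⟨x, hx, rfl⟩, y, hy, hxy⟩
    have h1 : -y + x ∈ H := (QuotientAddGroup.eq (s := H)).1 hxy
    have h2 : x ∈ H := ⟨hx, by simpa using add_mem hy h1.2⟩
    exact (QuotientAddGroup.eq_zero_iff x).2 h2
  · rw [AddSubgroup.coe_map, ← Set.image_add, hC]
  · rw [AddSubgroup.coe_map, ← Set.image_add, hD]
  · obtain ⟨x, hx, hx'⟩ := h
    exact ⟨π x, Set.mem_image_of_mem _ hx, fun hm => hx' (preimage_image_mk p2 ▸ hm)⟩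
  · obtain ⟨x, hx, hx'⟩ := h'
    exact ⟨π x, Set.mem_image_of_mem _ hx, fun hm => hx' (preimage_image_mk p1 ▸ hm)⟩

end KneserUnion
section CommonPeriod

variable {G : Type*} [AddCommGroup G]

lemma period_sdiff {H : AddSubgroup G} {C D : Set G} (hC : C + (H : Set G) = C)
    (hD : D + (H : Set G) = D) : C \ D + (H : Set G) = C \ D :=
  period_of_mem fun x hx h hh => ⟨mem_add_of_period hC hx.1 hh, fun h' => hx.2 <| by
    simpa using mem_add_of_period hD h' (neg_mem hh)⟩

lemma PosInv.eq_empty_of_period {M : (G → ℝ) → ℝ} (hM : PosInv M) (hone : M (fun _ => 1) = 1)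
    {H : AddSubgroup G} [H.FiniteIndex] {C : Set G} (hC : C + (H : Set G) = C)
    (h0 : M (chi C) = 0) : C = ∅ := by
  by_contra hne
  obtain ⟨x, hx⟩ := Set.nonempty_iff_ne_empty.2 hne
  have h1 : M (chi (sh (-x) (H : Set G))) = 0 := hM.chi_eq_zero_of_subset (fun y hy => by
    simpa using mem_add_of_period hC hx (show y + -x ∈ H from hy)) h0
  have h2 := hM.index_mul_chi H
  rw [hM.chi_sh] at h1
  rw [h1, hone] at h2
  simp at h2

/-- Periodic sets almost contained in `C` which satisfy a Kneser-type inequality. -/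
def Admissible (ν : (G → ℝ) → ℝ) (s : ℝ) (C D : Set G) : Prop :=
  ∃ H : AddSubgroup G, H.FiniteIndex ∧ D + (H : Set G) = D ∧ ν (chi (D \ C)) = 0 ∧
    s ≤ ν (chi D) + ν (chi (H : Set G))

variable {ν : (G → ℝ) → ℝ} {s : ℝ} {C D D' : Set G}

lemma Admissible.union (hν : PosInv ν) (h : Admissible ν s C D) (h' : Admissible ν s C D') :
    Admissible ν s C (D ∪ D') := by
  rcases (D \ D').eq_empty_or_nonempty with he | hne
  · rwa [Set.union_eq_self_of_subset_left (Set.sdiff_eq_empty.1 he)]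
  rcases (D' \ D).eq_empty_or_nonempty with he' | hne'
  · rwa [Set.union_eq_self_of_subset_right (Set.sdiff_eq_empty.1 he')]
  obtain ⟨H, hH, hp, h0, hs⟩ := h
  obtain ⟨H', hH', hp', h0', hs'⟩ := h'
  refine ⟨H ⊓ H', inferInstance, ?_, ?_, ?_⟩
  · rw [Set.union_add, period_mono hp inf_le_left, period_mono hp' inf_le_right]
  · rw [Set.union_sdiff_distrib]
    exact hν.chi_union_eq_zero h0 h0'
  · rcases hν.chi_union_periodic hp hp' hne hne' with k | k <;> linarith

lemma finite_admissible_values (hν : PosInv ν) (hone : ν (fun _ => 1) = 1)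
    (hs : ν (chi C) < s) : {x | ∃ D, Admissible ν s C D ∧ ν (chi D) = x}.Finite := by
  obtain ⟨N, hN⟩ := exists_nat_gt (1 / (s - ν (chi C)))
  refine Set.Finite.subset (((Set.finite_Iio N).prod (Set.finite_Iio N)).image
    fun p : ℕ × ℕ => (p.1 : ℝ) / p.2) ?_
  rintro _ ⟨D, ⟨H, hH, hp, h0, hsH⟩, rfl⟩
  have h1 := hν.index_mul_chi H
  rw [hone] at h1
  have h2 := hν.chi_le_of_diff_eq_zero h0
  have hi : (0 : ℝ) < H.index := by exact_mod_cast Nat.pos_of_ne_zero hH.index_ne_zero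
  have h3 : H.index < N := by
    have : (H.index : ℝ) < N := by
      refine lt_of_le_of_lt ?_ hN
      rw [le_div_iff₀ (by linarith), ← h1]
      exact mul_le_mul_of_nonneg_left (by linarith) hi.le
    exact_mod_cast this
  refine ⟨((QuotientAddGroup.mk '' D : Set (G ⧸ H)).ncard, H.index), ⟨?_, h3⟩, ?_⟩
  · exact lt_of_le_of_lt (Set.ncard_le_card _) h3
  · rw [ncard_image_mk_mul hν hp, eq_div_of_mul_eq hi.ne' ((mul_comm _ _).trans h1)]
    simp [div_eq_mul_inv]

variable {A B : Set G}

/-- Kneser's theorem for an extreme invariant mean. -/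
lemma exists_period_add (hν : ν ∈ (invMeans G).extremePoints ℝ) (hA : A.Nonempty)
    (hB : B.Nonempty) (hlt : ν (chi (A + B)) < ν (chi A) + ν (chi B)) :
    ∃ K : AddSubgroup G, K.FiniteIndex ∧ ν (chi ((A + B + (K : Set G)) \ (A + B))) = 0 ∧
      K.index * (ν (chi A) + ν (chi B) - ν (chi (A + B))) ≤ 1 := by
  have hν' := hν.1.1
  have hone := hν.1.2.1
  set s := ν (chi A) + ν (chi B)
  have hex : ∀ c ∈ A + B, ∃ D, Admissible ν s (A + B) D ∧ c ∈ D := fun c hc => by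
    obtain ⟨D, H, h1, h2, h3, h4, h5⟩ := exists_periodic_subset hν hlt hc
    exact ⟨D, ⟨H, h1, h3, h4, h5⟩, h2⟩
  obtain ⟨c, hc⟩ := hA.add hB
  obtain ⟨D₀, hD₀, -⟩ := hex c hc
  obtain ⟨_, ⟨D, hD, rfl⟩, hmax⟩ := Set.exists_max_image _ id
    (finite_admissible_values hν' hone hlt) ⟨_, D₀, hD₀, rfl⟩
  have hsub : A + B ⊆ D := by
    intro c hc
    obtain ⟨D', hD', hcD'⟩ := hex c hc
    have h1 : ν (chi (D ∪ D')) ≤ ν (chi D) := hmax _ ⟨_, hD.union hν' hD', rfl⟩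
    obtain ⟨H, hH, hp, -⟩ := hD
    obtain ⟨H', hH', hp', -⟩ := hD'
    have h2 := hν'.chi_union (S := D) (T := D' \ D) Set.disjoint_sdiff_right
    rw [Set.union_sdiff_self] at h2
    have h3 : D' \ D = ∅ := hν'.eq_empty_of_period hone (H := H ⊓ H')
      (period_sdiff (period_mono hp' inf_le_right) (period_mono hp inf_le_left))
      (le_antisymm (by linarith) (hν'.chi_nonneg _))
    exact Set.sdiff_eq_empty.1 h3 hcD'
  obtain ⟨K, hK, hp, h0, hs⟩ := hD
  refine ⟨K, hK, hν'.chi_eq_zero_of_subset (Set.sdiff_subset_sdiff_left ?_) h0, ?_⟩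
  · rw [← hp]
    exact Set.add_subset_add_right hsub
  · rw [← hone, ← hν'.index_mul_chi K]
    have := hν'.chi_le_of_diff_eq_zero h0
    exact mul_le_mul_of_nonneg_left (by linarith) (Nat.cast_nonneg _)

lemma subset_add_subgroup (C : Set G) (K : AddSubgroup G) : C ⊆ C + (K : Set G) :=
  fun x hx => ⟨x, hx, 0, K.zero_mem, add_zero x⟩

lemma period_add_subgroup (C : Set G) (K : AddSubgroup G) :
    C + (K : Set G) + (K : Set G) = C + (K : Set G) := by
  rw [add_assoc, coe_add_coe]

lemma exists_stabilizer_add (hν : ν ∈ (invMeans G).extremePoints ℝ) (hA : A.Nonempty)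
    (hB : B.Nonempty) (hlt : ν (chi (A + B)) < ν (chi A) + ν (chi B)) :
    ∃ K : AddSubgroup G, K.FiniteIndex ∧ ν (chi ((A + B + (K : Set G)) \ (A + B))) = 0 ∧
      K.index * (ν (chi A) + ν (chi B) - ν (chi (A + B))) ≤ 1 ∧
      AddAction.stabilizer G (A + B + (K : Set G)) = K := by
  obtain ⟨K, hK, h0, h1⟩ := exists_period_add hν hA hB hlt
  set C := A + B
  set K' := AddAction.stabilizer G (C + (K : Set G)) with hK'
  have hle : K ≤ K' := fun g hg => by
    have hsub : ∀ g ∈ K, g +ᵥ (C + (K : Set G)) ⊆ C + (K : Set G) := by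
      rintro g hg _ ⟨x, hx, rfl⟩
      simpa [add_comm] using mem_add_of_period (period_add_subgroup C K) hx hg
    refine AddAction.mem_stabilizer_iff.2 (Set.Subset.antisymm (hsub g hg) ?_)
    rw [Set.subset_vadd_set_iff]
    exact hsub _ (neg_mem hg)
  have heq : C + (K' : Set G) = C + (K : Set G) := by
    refine Set.Subset.antisymm ?_ (Set.add_subset_add_left hle)
    rintro _ ⟨x, hx, g, hg, rfl⟩
    have h := AddAction.mem_stabilizer_iff.1 hg
    rw [← h]
    exact ⟨x, subset_add_subgroup C K hx, by simp [add_comm]⟩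
  have hKi := AddSubgroup.index_antitone hle
  refine ⟨K', AddSubgroup.finiteIndex_of_le hle, by rw [heq]; exact h0,
    le_trans (mul_le_mul_of_nonneg_right (by exact_mod_cast hKi) (by linarith)) h1, by rw [heq]⟩

lemma add_inf_eq (hν : PosInv ν) (hone : ν (fun _ => 1) = 1) {C : Set G} {K K' : AddSubgroup G}
    [K.FiniteIndex] [K'.FiniteIndex] (h : ν (chi ((C + (K : Set G)) \ C)) = 0) :
    C + (K : Set G) = C + ((K ⊓ K' : AddSubgroup G) : Set G) := by
  refine Set.Subset.antisymm (Set.sdiff_eq_empty.1 ?_) (Set.add_subset_add_left fun x hx => hx.1)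
  refine hν.eq_empty_of_period hone (H := K ⊓ K') (period_sdiff
    (period_mono (period_add_subgroup C K) inf_le_left) (period_add_subgroup _ _)) ?_
  exact hν.chi_eq_zero_of_subset (Set.sdiff_subset_sdiff_right (subset_add_subgroup _ _)) h

/-- The period of `A + B` does not depend on the extreme invariant mean. -/
lemma exists_common_period (hA : A.Nonempty) (hB : B.Nonempty) :
    ∃ K : AddSubgroup G, K.FiniteIndex ∧ ∀ ν ∈ (invMeans G).extremePoints ℝ,
      ν (chi (A + B)) < ν (chi A) + ν (chi B) →
      ν (chi ((A + B + (K : Set G)) \ (A + B))) = 0 ∧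
      K.index * (ν (chi A) + ν (chi B) - ν (chi (A + B))) ≤ 1 := by
  by_cases hex : ∃ ν ∈ (invMeans G).extremePoints ℝ, ν (chi (A + B)) < ν (chi A) + ν (chi B)
  · obtain ⟨ν, hν, hlt⟩ := hex
    obtain ⟨K, hK, h0, -, hst⟩ := exists_stabilizer_add hν hA hB hlt
    refine ⟨K, hK, fun μ hμ hlt' => ?_⟩
    obtain ⟨K', hK', h0', h1, hst'⟩ := exists_stabilizer_add hμ hA hB hlt'
    have h : K = K' := by
      rw [← hst, ← hst', add_inf_eq hν.1.1 hν.1.2.1 (K' := K') h0,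
        add_inf_eq hμ.1.1 hμ.1.2.1 (K' := K) h0', inf_comm]
    subst h
    exact ⟨h0', h1⟩
  · push Not at hex
    exact ⟨⊤, inferInstance, fun ν hν hlt => absurd hlt (hex ν hν).not_gt⟩

/-- The deficiency of any invariant functional is controlled by the mass that avoids finitely
many translates of the holes of `A + B`. -/
lemma exists_index_mul_le (hA : A.Nonempty) (hB : B.Nonempty) :
    ∃ K : AddSubgroup G, K.FiniteIndex ∧ ∀ M : (G → ℝ) → ℝ, PosInv M → ∀ F : Finset G,
      K.index * (M (chi A) + M (chi B) - M (chi (A + B))) ≤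
        M (chi ((F : Set G) + (A + B + (K : Set G)) \ (A + B))ᶜ) := by
  classical
  obtain ⟨K, hK, hext⟩ := exists_common_period hA hB
  refine ⟨K, hK, fun M hM F => ?_⟩
  set Z := (A + B + (K : Set G)) \ (A + B) with hZ
  set E := ((F : Set G) + Z)ᶜ with hE
  rcases (hM.nonneg _ (bdd_const 1) fun _ => zero_le_one).eq_or_lt with h1 | h1
  · have h0 : ∀ S : Set G, M (chi S) = 0 := fun S =>
      hM.chi_eq_zero_of_subset (Set.subset_univ S) (by rw [chi_univ, ← h1])
    simp [h0]
  by_contra! hlt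
  let P : Set G → ((G → ℝ) → ℝ) →L[ℝ] ℝ := fun S =>
    ContinuousLinearMap.proj (R := ℝ) (φ := fun _ : G → ℝ => ℝ) (chi S)
  have hP : ∀ S (μ : (G → ℝ) → ℝ), P S μ = μ (chi S) := fun S μ => rfl
  let l : ((G → ℝ) → ℝ) →L[ℝ] ℝ := (K.index : ℝ) • (P A + P B - P (A + B)) - P E
  have hl : ∀ μ, l μ = K.index * (μ (chi A) + μ (chi B) - μ (chi (A + B))) - μ (chi E) :=
    fun μ => rfl
  set c := M fun _ => 1
  have hN : (fun f => if Bdd f then M f / c else 0) ∈ invMeans G := by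
    refine ⟨⟨⟨fun f g hf hg => ?_, fun a f hf => ?_, fun f hf h0 => ?_⟩, fun t f hf => ?_⟩, ?_,
      fun f hf => if_neg hf⟩
    · simp only [if_pos hf, if_pos hg, if_pos (hf.add hg), hM.add f g hf hg, add_div]
    · simp only [if_pos hf, if_pos (hf.const_mul a), hM.const_mul a f hf, mul_div_assoc]
    · simp only [if_pos hf]
      exact div_nonneg (hM.nonneg f hf h0) h1.le
    · simp only [if_pos hf, if_pos (hf.comp _), hM.shift t f hf]
    · simp only [if_pos (bdd_const 1)]
      exact div_self h1.ne'
  obtain ⟨ν, hν, hpos⟩ := exists_extreme_pos l hN (by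
    simp only [hl, if_pos (bdd_chi _)]
    rw [← add_div, ← sub_div, ← mul_div_assoc, ← sub_div]
    exact div_pos (by linarith) h1)
  have hν' := hν.1.1
  rw [hl] at hpos
  have hnn := hν'.chi_nonneg E
  have hK0 : (0 : ℝ) ≤ K.index := Nat.cast_nonneg _
  obtain ⟨k1, k2⟩ := hext ν hν (by by_contra! h; nlinarith)
  have k3 : ν (chi ((F : Set G) + Z)) = 0 := by
    have : (F : Set G) + Z = ⋃ g ∈ F, sh (-g) Z := by
      ext x
      simp only [Set.mem_add, Set.mem_iUnion, sh, Set.mem_ofPred_eq, exists_prop, Finset.mem_coe]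
      constructor
      · rintro ⟨g, hg, z, hz, rfl⟩
        exact ⟨g, hg, by simpa using hz⟩
      · rintro ⟨g, hg, hz⟩
        exact ⟨g, hg, _, hz, by abel⟩
    rw [this]
    exact hν'.chi_biUnion_eq_zero _ _ fun g _ => (hν'.chi_sh _ _).trans k1
  have k4 := hν'.chi_compl ((F : Set G) + Z)
  rw [hν.1.2.1, k3, ← hE] at k4
  linarith

end CommonPeriod
section Concentration

variable {G : Type*} [AddCommGroup G] {M : (G → ℝ) → ℝ}

lemma PosLin.abs_sub_le {X : Type*} {M : (X → ℝ) → ℝ} (hM : PosLin M) {f : X → ℝ} {C : ℝ}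
    (hf : ∀ x, |f x| ≤ C) (S T : Set X) :
    |M (fun x => f x * chi S x) - M (fun x => f x * chi T x)| ≤
      C * (M (chi (S \ T)) + M (chi (T \ S))) := by
  have hb : Bdd f := ⟨C, hf⟩
  have hd : Bdd fun x => C * (chi (S \ T) x + chi (T \ S) x) :=
    ((bdd_chi _).add (bdd_chi _)).const_mul _
  have hle : ∀ x, |f x * chi S x - f x * chi T x| ≤ C * (chi (S \ T) x + chi (T \ S) x) := by
    intro x
    have h0 := (abs_nonneg _).trans (hf x)
    by_cases h : x ∈ S <;> by_cases h' : x ∈ T <;> simp [chi, h, h', hf x]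
  rw [← hM.add _ _ (bdd_chi _) (bdd_chi _), ← hM.const_mul _ _ ((bdd_chi _).add (bdd_chi _)),
    ← hM.sub (hb.mul (bdd_chi _)) (hb.mul (bdd_chi _)), _root_.abs_le, ← neg_one_mul,
    ← hM.const_mul _ _ hd]
  exact ⟨hM.mono (hd.const_mul _) ((hb.mul (bdd_chi _)).sub (hb.mul (bdd_chi _))) fun x => by
      linarith [(_root_.abs_le.1 (hle x)).1],
    hM.mono ((hb.mul (bdd_chi _)).sub (hb.mul (bdd_chi _))) hd fun x =>
      (_root_.abs_le.1 (hle x)).2⟩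

/-- A decreasing sequence of sets, avoiding more and more translates of `Z`, whose densities
converge to the smallest possible value. -/
lemma exists_avoiding_sequence (hM : PosLin M) (Z : Set G) :
    ∃ F : ℕ → Finset G, Antitone (fun n => ((F n : Set G) + Z)ᶜ) ∧ (∀ n, 0 ∈ F n) ∧
      ∀ (n : ℕ) (F' : Finset G),
        M (chi (((F n : Set G) + Z)ᶜ \ ((F' : Set G) + Z)ᶜ)) ≤ 1 / ((n : ℝ) + 1) := by
  classical
  set V := Set.range fun F : Finset G => M (chi ((F : Set G) + Z)ᶜ) with hV
  have hbdd : BddBelow V := ⟨0, by rintro _ ⟨F, rfl⟩; exact hM.chi_nonneg _⟩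
  have hex : ∀ n : ℕ, ∃ F : Finset G, M (chi ((F : Set G) + Z)ᶜ) < sInf V + 1 / ((n : ℝ) + 1) := by
    intro n
    obtain ⟨_, ⟨F, rfl⟩, hF⟩ := exists_lt_of_csInf_lt (Set.range_nonempty _)
      (lt_add_of_pos_right (sInf V) (Nat.one_div_pos_of_nat (α := ℝ) (n := n)))
    exact ⟨F, hF⟩
  choose F hF using hex
  refine ⟨fun n => insert 0 ((Finset.range (n + 1)).biUnion F), fun m n hmn => ?_, fun n => ?_,
    fun n F' => ?_⟩
  · refine Set.compl_subset_compl.2 (Set.add_subset_add_right (Finset.coe_subset.2 ?_))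
    exact Finset.insert_subset_insert _ (Finset.biUnion_subset_biUnion_of_subset_left _
      (Finset.range_subset_range.2 (by lia)))
  · simp
  · set F₀ := insert 0 ((Finset.range (n + 1)).biUnion F)
    have h1 := hM.chi_inter_add_diff ((F₀ : Set G) + Z)ᶜ ((F' : Set G) + Z)ᶜ
    rw [← Set.compl_union, ← Set.union_add, ← Finset.coe_union] at h1
    have h2 : sInf V ≤ M (chi ((↑(F₀ ∪ F') : Set G) + Z)ᶜ) := csInf_le hbdd ⟨_, rfl⟩
    have h3 : M (chi ((F₀ : Set G) + Z)ᶜ) ≤ M (chi ((F n : Set G) + Z)ᶜ) := by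
      refine hM.chi_mono (Set.compl_subset_compl.2 (Set.add_subset_add_right
        (Finset.coe_subset.2 ?_)))
      exact (Finset.subset_biUnion_of_mem F (by simp)).trans (Finset.subset_insert _ _)
    linarith [hF n]

lemma sh_compl_add (t : G) (F : Finset G) (Z : Set G) :
    ∃ F' : Finset G, sh t ((F : Set G) + Z)ᶜ = ((F' : Set G) + Z)ᶜ := by
  classical
  refine ⟨F.image (· - t), ?_⟩
  ext x
  simp only [sh, Set.mem_ofPred_eq, Set.mem_compl_iff, not_iff_not, Finset.coe_image]
  constructor
  · rintro ⟨g, hg, z, hz, h⟩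
    exact ⟨g - t, ⟨g, hg, rfl⟩, z, hz, by simp only at h ⊢; rw [sub_add_eq_add_sub, h]; abel⟩
  · rintro ⟨_, ⟨g, hg, rfl⟩, z, hz, rfl⟩
    exact ⟨g, hg, z, hz, by simp only; abel⟩

/-- Restricting to an asymptotically invariant decreasing sequence of sets preserves
invariance. -/
lemma PosInv.restrict (hM : PosInv M) {E : ℕ → Set G}
    (hE : ∀ n t, M (chi (E n \ sh t (E n))) ≤ 1 / ((n : ℝ) + 1)) {N : (G → ℝ) → ℝ}
    (hN : PosLin N)
    (hlim : ∀ f, Bdd f → Tendsto (fun n => M (fun x => f x * chi (E n) x)) atTop (nhds (N f))) :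
    PosInv N := by
  refine ⟨hN, fun t f hf => ?_⟩
  obtain ⟨C, hC⟩ := hf
  have hf : Bdd f := ⟨C, hC⟩
  have hC0 : 0 ≤ C := (abs_nonneg _).trans (hC 0)
  refine tendsto_nhds_unique (hlim _ (hf.comp (· + t))) ?_
  have hz : Tendsto (fun n : ℕ => C * (2 * (1 / ((n : ℝ) + 1)))) atTop (nhds 0) := by
    simpa using (tendsto_one_div_add_atTop_nhds_zero_nat.const_mul (2 : ℝ)).const_mul C
  have hd : Tendsto (fun n => M (fun x => f (x + t) * chi (E n) x) -
      M (fun x => f x * chi (E n) x)) atTop (nhds 0) := by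
    refine squeeze_zero_norm (fun n => ?_) hz
    rw [← hM.shift t (fun x => f x * chi (E n) x) (hf.mul (bdd_chi _))]
    have h1 : (fun x => f (x + t) * chi (E n) (x + t)) =
        fun x => f (x + t) * chi (sh t (E n)) x := by
      rw [← SumsetMeans.chi_sh]
    rw [h1]
    refine (hM.abs_sub_le (f := fun x => f (x + t)) (fun x => hC _) _ _).trans ?_
    have h2 := hM.chi_inter_add_diff (E n) (sh t (E n))
    have h3 := hM.chi_inter_add_diff (sh t (E n)) (E n)
    rw [hM.chi_sh, Set.inter_comm] at h3
    exact mul_le_mul_of_nonneg_left (by linarith [hE n t]) hC0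
  simpa using hd.add (hlim f hf)

/-- The part of an invariant functional living away from `Z = (A + B + K) \ (A + B)` is
responsible for the whole deficiency. -/
lemma PosInv.exists_concentrated (hM : PosInv M) {A B : Set G} {K : AddSubgroup G}
    (hK : K.FiniteIndex)
    (hineq : ∀ M : (G → ℝ) → ℝ, PosInv M → ∀ F : Finset G,
      K.index * (M (chi A) + M (chi B) - M (chi (A + B))) ≤
        M (chi ((F : Set G) + (A + B + (K : Set G)) \ (A + B))ᶜ)) :
    ∃ (E : ℕ → Set G) (N : (G → ℝ) → ℝ), Antitone E ∧ PosInv N ∧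
      (∀ n t, M (chi (E n \ sh t (E n))) ≤ 1 / ((n : ℝ) + 1)) ∧
      (∀ m n, M (chi (E m \ E n)) ≤ 1 / ((m : ℝ) + 1)) ∧
      (∀ f, Bdd f → Tendsto (fun n => M (fun x => f x * chi (E n) x)) atTop (nhds (N f))) ∧
      N (chi ((A + B + (K : Set G)) \ (A + B))) = 0 ∧
      M (chi A) + M (chi B) - M (chi (A + B)) ≤ N (chi A) + N (chi B) - N (chi (A + B)) ∧
      K.index * (N (chi A) + N (chi B) - N (chi (A + B))) ≤ N (fun _ => 1) := by
  set Z := (A + B + (K : Set G)) \ (A + B) with hZ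
  obtain ⟨F, hanti, h0, hF⟩ := exists_avoiding_sequence hM.toPosLin Z
  set E : ℕ → Set G := fun n => ((F n : Set G) + Z)ᶜ with hE
  have hsh : ∀ n t, M (chi (E n \ sh t (E n))) ≤ 1 / ((n : ℝ) + 1) := fun n t => by
    obtain ⟨F', hF'⟩ := sh_compl_add t (F n) Z
    rw [hF']
    exact hF n F'
  obtain ⟨N, hN, hlim⟩ := hM.exists_restrict E hanti
  have hN' := hM.restrict hsh hN hlim
  have hlim1 : Tendsto (fun n => M (chi (E n))) atTop (nhds (N fun _ => 1)) := by
    simpa using hlim _ (bdd_const 1)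
  have hle : ∀ f, Bdd f → (∀ x, 0 ≤ f x) → N f ≤ M f := fun f hf h0 =>
    le_of_tendsto' (hlim f hf) fun n => hM.mono (hf.mul (bdd_chi _)) hf fun x =>
      mul_le_of_le_one_right (h0 x) (chi_le_one _ _)
  have hNE : ∀ n, N (chi (E n)) = N fun _ => 1 := fun n => by
    refine tendsto_nhds_unique (hlim _ (bdd_chi _)) (hlim1.congr' ?_)
    filter_upwards [eventually_ge_atTop n] with k hk
    congr 1; ext x
    rw [← chi_inter, Set.inter_eq_right.2 (hanti hk)]
  have hR : PosInv fun f => M f - N f := by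
    refine ⟨⟨fun f g hf hg => ?_, fun c f hf => ?_, fun f hf h0 => sub_nonneg.2 (hle f hf h0)⟩,
      fun t f hf => ?_⟩
    · simp only [hM.add f g hf hg, hN.add f g hf hg]; ring
    · simp only [hM.const_mul c f hf, hN.const_mul c f hf]; ring
    · simp only [hM.shift t f hf, hN'.shift t f hf]
  have hi : (0 : ℝ) < K.index := by exact_mod_cast Nat.pos_of_ne_zero hK.index_ne_zero
  refine ⟨E, N, hanti, hN', hsh, fun m n => hF m (F n), hlim, ?_, ?_,
    (hineq N hN' (F 0)).trans (hNE 0).le⟩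
  · refine tendsto_nhds_unique (hlim _ (bdd_chi Z)) ?_
    refine tendsto_const_nhds.congr fun n => ?_
    rw [← hM.chi_empty]
    congr 1; ext x
    rw [← chi_inter]
    congr 1
    refine (Set.eq_empty_of_forall_notMem ?_).symm
    rintro y ⟨hy, hy'⟩
    exact hy' ⟨0, h0 n, y, hy, zero_add y⟩
  · have h1 : Tendsto (fun n => M (chi (E n)) - N (chi (E n))) atTop (nhds 0) := by
      simpa [hNE] using hlim1.sub_const (N fun _ => 1)
    have h2 := ge_of_tendsto' h1 fun n => hineq _ hR (F n)
    have h3 := nonpos_of_mul_nonpos_right h2 hi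
    linarith

end Concentration
section Averages

/-- The average of a function over a finite set. -/
noncomputable def avg {X : Type*} (S : Finset X) (f : X → ℝ) : ℝ := (∑ x ∈ S, f x) / S.card

lemma posLin_avg {X : Type*} (S : Finset X) : PosLin (avg S) := by
  refine ⟨fun f g _ _ => ?_, fun c f _ => ?_, fun f _ h => ?_⟩
  · rw [avg, Finset.sum_add_distrib, add_div, avg, avg]
  · rw [avg, ← Finset.mul_sum, mul_div_assoc, avg]
  · exact div_nonneg (Finset.sum_nonneg fun x _ => h x) (Nat.cast_nonneg _)

lemma avg_one {X : Type*} {S : Finset X} (hS : S.Nonempty) : avg S (fun _ => 1) = 1 := by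
  have : (S.card : ℝ) ≠ 0 := by exact_mod_cast hS.card_ne_zero
  simp [avg, this]

lemma avg_chi_eq_card_filter {X : Type*} (S : Finset X) (C : Set X) [DecidablePred (· ∈ C)] :
    avg S (chi C) = ((S.filter (· ∈ C)).card : ℝ) / S.card := by
  rw [avg, Finset.card_filter]
  simp [chi, Set.indicator_apply]

lemma avg_chi {X : Type*} (S : Finset X) (C : Set X) :
    avg S (chi C) = ((C ∩ (S : Set X)).ncard : ℝ) / S.card := by
  classical
  have h : C ∩ (S : Set X) = (S.filter (· ∈ C) : Finset X) := by ext; simp [and_comm]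
  rw [avg_chi_eq_card_filter, h, Set.ncard_coe_finset]

lemma abs_sum_sub_sum_le {X : Type*} [DecidableEq X] {f : X → ℝ} {C : ℝ} (hf : ∀ x, |f x| ≤ C)
    (S T : Finset X) : |∑ x ∈ T, f x - ∑ x ∈ S, f x| ≤ C * (symmDiff S T).card := by
  have hb : ∀ U : Finset X, |∑ x ∈ U, f x| ≤ C * U.card := fun U =>
    (Finset.abs_sum_le_sum_abs _ _).trans <| (Finset.sum_le_card_nsmul U _ C fun x _ => hf x).trans
      (by rw [nsmul_eq_mul, mul_comm])
  have hcard : ((symmDiff S T).card : ℝ) = (S \ T).card + (T \ S).card := by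
    rw [← Nat.cast_add, ← Finset.card_union_of_disjoint disjoint_sdiff_sdiff]
    rfl
  rw [← Finset.sum_sdiff_sub_sum_sdiff, hcard, mul_add, add_comm]
  exact (abs_sub _ _).trans (add_le_add (hb _) (hb _))

variable {I : Type*} [Preorder I]

/-- A net of finite sets on which averages converge can be thinned out so as to be asymptotically
contained in each member of a decreasing sequence of sets, losing little mass. -/
lemma exists_selection {X : Type*} {Φ : I → Finset X} {M : (X → ℝ) → ℝ}
    (hΦ : ∀ f, Bdd f → Tendsto (fun i => avg (Φ i) f) atTop (nhds (M f)))
    {E : ℕ → Set X} (hE : Antitone E) (hM : ∀ m n, M (chi (E m \ E n)) ≤ 1 / ((m : ℝ) + 1)) :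
    ∃ G : I → Set X, ∀ n : ℕ, ∀ᶠ i in atTop, G i ⊆ E n ∧
      avg (Φ i) (chi (E n \ G i)) ≤ 2 * (1 / ((n : ℝ) + 1)) := by
  let S : I → Set ℕ := fun i =>
    {n | ∀ m ∈ Set.Iic n, avg (Φ i) (chi (E m \ E n)) ≤ 2 * (1 / ((m : ℝ) + 1))}
  have hS : ∀ n, ∀ᶠ i in atTop, n ∈ S i := fun n =>
    (Set.finite_Iic n).eventually_all.2 fun m _ => by
      have hpos : (0 : ℝ) < 1 / ((m : ℝ) + 1) := Nat.one_div_pos_of_nat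
      exact (hΦ _ (bdd_chi _)).eventually_le_const (by linarith [hM m n])
  refine ⟨fun i => ⋂ n ∈ S i, E n, fun n => (hS n).mono fun i hi =>
    ⟨Set.biInter_subset_of_mem hi, ?_⟩⟩
  have key : ∀ T : Finset X, ∃ k ∈ S i, n ≤ k ∧ ∀ x ∈ T, x ∈ E k → x ∈ ⋂ n ∈ S i, E n := by
    classical
    intro T
    induction T using Finset.induction_on with
    | empty => exact ⟨n, hi, le_rfl, by simp⟩
    | insert a T _ ih =>
      obtain ⟨k, hk, hnk, hT⟩ := ih
      by_cases ha : a ∈ ⋂ n ∈ S i, E n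
      · refine ⟨k, hk, hnk, fun x hx hxk => ?_⟩
        rcases Finset.mem_insert.1 hx with rfl | hx
        exacts [ha, hT x hx hxk]
      · simp only [Set.mem_iInter, not_forall] at ha
        obtain ⟨l, hl, hal⟩ := ha
        refine ⟨max k l, ?_, hnk.trans (le_max_left _ _), fun x hx hxk => ?_⟩
        · rcases le_total k l with h | h
          · rwa [max_eq_right h]
          · rwa [max_eq_left h]
        · rcases Finset.mem_insert.1 hx with rfl | hx
          · exact absurd (hE (le_max_right _ _) hxk) hal
          · exact hT x hx (hE (le_max_left _ _) hxk)
  obtain ⟨k, hk, hnk, hT⟩ := key (Φ i)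
  refine le_trans ?_ (hk n hnk)
  rw [avg, avg]
  refine div_le_div_of_nonneg_right (Finset.sum_le_sum fun x hx => ?_) (Nat.cast_nonneg _)
  by_cases hxk : x ∈ E k
  · rw [chi_of_notMem fun h => h.2 (hT x hx hxk)]
    exact chi_nonneg _ _
  · by_cases hxn : x ∈ E n
    · rw [chi_of_mem (show x ∈ E n \ E k from ⟨hxn, hxk⟩)]
      exact chi_le_one _ _
    · rw [chi_of_notMem fun h => hxn h.1]
      exact chi_nonneg _ _

/-- The averages over a thinned out net converge to the restricted functional. -/
lemma tendsto_avg_selection {X : Type*} {Φ : I → Finset X} {M N : (X → ℝ) → ℝ}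
    (hΦ : ∀ f, Bdd f → Tendsto (fun i => avg (Φ i) f) atTop (nhds (M f)))
    {E : ℕ → Set X} {G : I → Set X}
    (hG : ∀ n : ℕ, ∀ᶠ i in atTop, G i ⊆ E n ∧
      avg (Φ i) (chi (E n \ G i)) ≤ 2 * (1 / ((n : ℝ) + 1)))
    {f : X → ℝ} (hf : Bdd f)
    (hN : Tendsto (fun n => M (fun x => f x * chi (E n) x)) atTop (nhds (N f))) :
    Tendsto (fun i => avg (Φ i) fun x => f x * chi (G i) x) atTop (nhds (N f)) := by
  have hf' := hf
  obtain ⟨C, hC⟩ := hf'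
  rw [Metric.tendsto_nhds]
  intro ε hε
  have hz : Tendsto (fun n : ℕ => |C| * (2 * (1 / ((n : ℝ) + 1)))) atTop (nhds 0) := by
    simpa using (tendsto_one_div_add_atTop_nhds_zero_nat.const_mul (2 : ℝ)).const_mul |C|
  obtain ⟨n, h1, h2⟩ := ((hz.eventually_lt_const (show 0 < ε / 3 by linarith)).and
    (Metric.tendsto_nhds.1 hN (ε / 3) (by linarith))).exists
  filter_upwards [hG n, Metric.tendsto_nhds.1 (hΦ _ (hf.mul (bdd_chi (E n)))) (ε / 3)
    (by linarith)] with i hi h3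
  have h4 := (posLin_avg (Φ i)).abs_sub_le (fun x => (hC x).trans (le_abs_self C)) (G i) (E n)
  rw [Set.sdiff_eq_empty.2 hi.1, (posLin_avg (Φ i)).chi_empty, zero_add] at h4
  have h5 := h4.trans (mul_le_mul_of_nonneg_left hi.2 (abs_nonneg C))
  rw [Real.dist_eq] at *
  have h6 := abs_sub_le (avg (Φ i) fun x => f x * chi (G i) x)
    (avg (Φ i) fun x => f x * chi (E n) x) (N f)
  have h7 := abs_sub_le (avg (Φ i) fun x => f x * chi (E n) x)
    (M fun x => f x * chi (E n) x) (N f)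
  linarith

end Averages
section Nets

variable {G I : Type*}

lemma dens_eq_avg (Φ : I → Finset G) (C : Set G) (i : I) : dens G Φ C i = avg (Φ i) (chi C) :=
  (avg_chi _ _).symm

lemma isFullNet_of_tendsto [TopologicalSpace G] [Preorder I] {Ψ : I → Finset G}
    {N : (G → ℝ) → ℝ}
    (h : ∀ f, Bdd f → Tendsto (fun i => avg (Ψ i) f) atTop (nhds (N f))) : IsFullNet G Ψ :=
  fun f => ⟨N f, h f ⟨‖f‖, f.norm_coe_le_norm⟩⟩

variable [AddCommGroup G]

lemma add_singleton_eq_image [DecidableEq G] (S : Finset G) (t : G) :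
    S + {t} = S.image (· + t) := by
  ext
  simp only [Finset.mem_add, Finset.mem_singleton, Finset.mem_image, exists_eq_left]

lemma coe_symmDiff_add_singleton [DecidableEq G] (S : Finset G) (t : G) :
    symmDiff (S : Set G) ((S : Set G) + {t}) = (symmDiff S (S + {t}) : Finset G) := by
  rw [Finset.coe_symmDiff, Finset.coe_add, Finset.coe_singleton]

/-- The mean defined by a full Følner net. -/
lemma exists_mean [TopologicalSpace G] [DiscreteTopology G] [Preorder I] [Nonempty I] [IsDirected I (· ≤ ·)] {Φ : I → Finset G} (hΦ : IsFolner G Φ)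
    (hfull : IsFullNet G Φ) :
    ∃ M : (G → ℝ) → ℝ, PosInv M ∧ M (fun _ => 1) = 1 ∧
      ∀ f, Bdd f → Tendsto (fun i => avg (Φ i) f) atTop (nhds (M f)) := by
  classical
  have hex : ∀ f : G → ℝ, Bdd f → ∃ L, Tendsto (fun i => avg (Φ i) f) atTop (nhds L) := by
    rintro f ⟨C, hC⟩
    exact hfull (BoundedContinuousFunction.ofNormedAddCommGroup f continuous_of_discreteTopology
      C hC)
  choose! M hM using hex
  refine ⟨M, ⟨⟨fun f g hf hg => ?_, fun c f hf => ?_, fun f hf h0 => ?_⟩, fun t f hf => ?_⟩, ?_, hM⟩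
  · exact tendsto_nhds_unique (hM _ (hf.add hg)) (((hM f hf).add (hM g hg)).congr fun i =>
      ((posLin_avg (Φ i)).add f g hf hg).symm)
  · exact tendsto_nhds_unique (hM _ (hf.const_mul c)) (((hM f hf).const_mul c).congr fun i =>
      ((posLin_avg (Φ i)).const_mul c f hf).symm)
  · exact ge_of_tendsto' (hM f hf) fun i => (posLin_avg (Φ i)).nonneg f hf h0
  · refine tendsto_nhds_unique (hM _ (hf.comp (· + t))) ?_
    obtain ⟨C, hC⟩ := hf
    have hz := (hΦ.2 t).const_mul C
    rw [mul_zero] at hz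
    have hd : Tendsto (fun i => avg (Φ i) (fun x => f (x + t)) - avg (Φ i) f) atTop (nhds 0) := by
      refine squeeze_zero_norm (fun i => ?_) hz
      have h1 : ∑ x ∈ Φ i, f (x + t) = ∑ x ∈ Φ i + {t}, f x := by
        rw [add_singleton_eq_image, Finset.sum_image fun x _ y _ h => add_right_cancel h]
      rw [avg, avg, ← sub_div, h1, Real.norm_eq_abs, abs_div, Nat.abs_cast,
        coe_symmDiff_add_singleton, Set.ncard_coe_finset, ← mul_div_assoc]
      exact div_le_div_of_nonneg_right (abs_sum_sub_sum_le hC _ _) (Nat.cast_nonneg _)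
    simpa using hd.add (hM f ⟨C, hC⟩)
  · exact tendsto_nhds_unique (hM _ (bdd_const 1)) (tendsto_const_nhds.congr fun i =>
      (avg_one (hΦ.1 i)).symm)

/-- The boundary of a thinned out finite set. -/
lemma card_symmDiff_filter_le [DecidableEq G] (S : Finset G) (t : G) {E H : Set G}
    [DecidablePred (· ∈ H)] (hHE : H ⊆ E) :
    (((symmDiff (S.filter (· ∈ H)) (S.filter (· ∈ H) + {t})).card : ℕ) : ℝ) / S.card ≤
      2 * ((symmDiff S (S + {t})).card / S.card + avg S (chi (E \ sh (-t) E)) +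
        avg S (chi (E \ H))) := by
  set U := S.filter (· ∈ H) with hU
  have hUt : (U + {t}).card = U.card := by
    rw [add_singleton_eq_image, Finset.card_image_of_injective _ (add_left_injective t)]
  have h1 : (symmDiff U (U + {t})).card = 2 * (U \ (U + {t})).card := by
    have h := Finset.card_union_of_disjoint (disjoint_sdiff_sdiff (x := U) (y := U + {t}))
    have h2 := Finset.card_sdiff_add_card U (U + {t})
    have h3 := Finset.card_sdiff_add_card (U + {t}) U
    rw [Finset.union_comm] at h3
    rw [show symmDiff U (U + {t}) = (U \ (U + {t})) ∪ ((U + {t}) \ U) from rfl, h]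
    lia
  classical
  have h2 : U \ (U + {t}) ⊆ symmDiff S (S + {t}) ∪ S.filter (· ∈ E \ sh (-t) E) ∪
      (S.filter (· ∈ E \ H)).image (· + t) := by
    intro x hx
    simp only [hU, add_singleton_eq_image, Finset.mem_sdiff, Finset.mem_filter, Finset.mem_image,
      not_exists, not_and, Finset.mem_union, Finset.mem_symmDiff, and_imp] at hx ⊢
    obtain ⟨⟨hxS, hxH⟩, hx⟩ := hx
    by_cases hS : x - t ∈ S
    · have hxt : x - t ∉ H := fun h => hx _ hS h (sub_add_cancel _ _)
      by_cases hE : x - t ∈ E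
      · exact Or.inr ⟨x - t, ⟨hS, hE, hxt⟩, sub_add_cancel _ _⟩
      · refine Or.inl (Or.inr ⟨hxS, hHE hxH, fun h => hE ?_⟩)
        rw [sub_eq_add_neg]
        exact h
    · refine Or.inl (Or.inl (Or.inl ⟨hxS, fun y hy h => hS ?_⟩))
      rwa [← h, add_sub_cancel_right]
  rw [avg_chi_eq_card_filter, avg_chi_eq_card_filter, ← add_div, ← add_div, ← mul_div_assoc, h1]
  refine div_le_div_of_nonneg_right ?_ (Nat.cast_nonneg _)
  have h3 := (Finset.card_le_card h2).trans ((Finset.card_union_le _ _).trans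
    (add_le_add (Finset.card_union_le _ _) Finset.card_image_le))
  exact_mod_cast Nat.mul_le_mul_left 2 h3

/-- A full Følner net can be thinned out so as to represent the normalized restriction of its
mean to an asymptotically invariant decreasing sequence of sets. -/
lemma exists_subnet [Preorder I] [Nonempty I] [IsDirected I (· ≤ ·)] {Φ : I → Finset G} (hΦ : IsFolner G Φ)
    {M N : (G → ℝ) → ℝ}
    (hM : ∀ f, Bdd f → Tendsto (fun i => avg (Φ i) f) atTop (nhds (M f)))
    {E : ℕ → Set G} (hE : Antitone E)
    (hinv : ∀ n t, M (chi (E n \ sh t (E n))) ≤ 1 / ((n : ℝ) + 1))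
    (hdiff : ∀ m n, M (chi (E m \ E n)) ≤ 1 / ((m : ℝ) + 1))
    (hN : ∀ f, Bdd f → Tendsto (fun n => M (fun x => f x * chi (E n) x)) atTop (nhds (N f)))
    (hpos : 0 < N (fun _ => 1)) :
    ∃ Ψ : I → Finset G, (∀ i, Ψ i ⊆ Φ i) ∧ IsFolner G Ψ ∧
      Tendsto (fun i => ((Ψ i).card : ℝ) / (Φ i).card) atTop (nhds (N (fun _ => 1))) ∧
      ∀ f, Bdd f → Tendsto (fun i => avg (Ψ i) f) atTop (nhds (N f / N (fun _ => 1))) := by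
  classical
  obtain ⟨W, hW⟩ := exists_selection hM hE hdiff
  have hlim := fun (f : G → ℝ) (hf : Bdd f) => tendsto_avg_selection hM hW hf (hN f hf)
  let U : I → Finset G := fun i => (Φ i).filter (· ∈ W i)
  let Ψ : I → Finset G := fun i => if (U i).Nonempty then U i else Φ i
  have hU : ∀ (f : G → ℝ) i, avg (Φ i) (fun x => f x * chi (W i) x) = (∑ x ∈ U i, f x) / (Φ i).card := by
    intro f i
    rw [avg, Finset.sum_filter]
    congr 2; ext x
    by_cases h : x ∈ W i <;> simp [chi, h]
  have hcardU : Tendsto (fun i => ((U i).card : ℝ) / (Φ i).card) atTop (nhds (N (fun _ => 1))) := by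
    refine (hlim _ (bdd_const 1)).congr fun i => ?_
    rw [hU]
    simp
  have hev : ∀ᶠ i in atTop, Ψ i = U i := by
    filter_upwards [hcardU.eventually_const_lt hpos] with i hi
    refine if_pos (Finset.card_pos.1 (Nat.pos_of_ne_zero fun h => ?_))
    rw [h] at hi
    simp at hi
  have hcard : Tendsto (fun i => ((Ψ i).card : ℝ) / (Φ i).card) atTop (nhds (N (fun _ => 1))) :=
    hcardU.congr' (hev.mono fun i hi => by simp only [hi])
  have hΦ0 : ∀ i, ((Φ i).card : ℝ) ≠ 0 := fun i => by exact_mod_cast (hΦ.1 i).card_ne_zero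
  refine ⟨Ψ, fun i => ?_, ⟨fun i => ?_, fun t => ?_⟩, hcard, fun f hf => ?_⟩
  · simp only [Ψ]
    split_ifs
    exacts [Finset.filter_subset _ _, subset_rfl]
  · simp only [Ψ]
    split_ifs with h
    exacts [h, hΦ.1 i]
  · have hbd : Tendsto (fun i => ((symmDiff (U i) (U i + {t})).card : ℝ) / (Φ i).card) atTop
        (nhds 0) := by
      rw [Metric.tendsto_nhds]
      intro ε hε
      have hz : Tendsto (fun n : ℕ => 1 / ((n : ℝ) + 1)) atTop (nhds 0) :=
        tendsto_one_div_add_atTop_nhds_zero_nat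
      obtain ⟨n, hn⟩ := (hz.eventually_lt_const (show 0 < ε / 16 by linarith)).exists
      filter_upwards [hW n, (hΦ.2 t).eventually_lt_const (show 0 < ε / 16 by linarith),
        (hM _ (bdd_chi (E n \ sh (-t) (E n)))).eventually_lt_const
          (show _ < ε / 16 from (hinv n (-t)).trans_lt hn)] with i h1 h2 h3
      have h4 := card_symmDiff_filter_le (Φ i) t h1.1
      rw [coe_symmDiff_add_singleton, Set.ncard_coe_finset] at h2
      rw [Real.dist_eq, sub_zero, abs_of_nonneg (by positivity)]
      refine h4.trans_lt ?_
      linarith [h1.2]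
    have hq := hbd.div hcardU hpos.ne'
    rw [zero_div] at hq
    refine hq.congr' (hev.mono fun i hi => ?_)
    simp only [Pi.div_apply]
    rw [hi, coe_symmDiff_add_singleton, Set.ncard_coe_finset]
    exact div_div_div_cancel_right₀ (hΦ0 i) _ _
  · refine ((hlim f hf).div hcardU hpos.ne').congr' (hev.mono fun i hi => ?_)
    simp only [Pi.div_apply]
    rw [hi, hU, avg]
    exact div_div_div_cancel_right₀ (hΦ0 i) _ _

end Nets
theorem full_folner_kneser (A B : Set Γ) (hA : A.Nonempty) (hB : B.Nonempty) :
    ∃ K : AddSubgroup Γ, K.FiniteIndex ∧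
      ∀ (I : Type*) [Preorder I] [Nonempty I] [IsDirected I (· ≤ ·)]
        (Φ : I → Finset Γ), IsFolner Γ Φ → IsFullNet Γ Φ →
        ∀ dA dB dAB δ : ℝ,
          Tendsto (dens Γ Φ A) atTop (nhds dA) →
          Tendsto (dens Γ Φ B) atTop (nhds dB) →
          Tendsto (dens Γ Φ (A + B)) atTop (nhds dAB) →
          δ = dA + dB - dAB → 0 < δ →
          ∃ Ψ : I → Finset Γ, (∀ i, Ψ i ⊆ Φ i) ∧ IsFolner Γ Ψ ∧ IsFullNet Γ Ψ ∧
            (K.index : ℝ) * δ ≤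
              liminf (fun i => ((Ψ i).card : ℝ) / ((Φ i).card : ℝ)) atTop ∧
            (∃ d : ℝ, Tendsto (dens Γ Ψ (A + B)) atTop (nhds d) ∧
              Tendsto (dens Γ Ψ (A + B + (K : Set Γ))) atTop (nhds d)) ∧
            (∃ eA eB eAB : ℝ, Tendsto (dens Γ Ψ A) atTop (nhds eA) ∧
              Tendsto (dens Γ Ψ B) atTop (nhds eB) ∧
              Tendsto (dens Γ Ψ (A + B)) atTop (nhds eAB) ∧
              δ ≤ eA + eB - eAB) := by
  obtain ⟨K, hK, hineq⟩ := exists_index_mul_le hA hB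
  refine ⟨K, hK, ?_⟩
  intro I _ _ _ Φ hΦ hfull dA dB dAB δ hdA hdB hdAB hδ hpos
  obtain ⟨M, hM, hone, hlim⟩ := exists_mean hΦ hfull
  have hval : ∀ {C : Set Γ} {d : ℝ}, Tendsto (dens Γ Φ C) atTop (nhds d) → d = M (chi C) :=
    fun h => tendsto_nhds_unique h ((hlim _ (bdd_chi _)).congr fun i => (dens_eq_avg Φ _ i).symm)
  rw [hval hdA, hval hdB, hval hdAB] at hδ
  obtain ⟨E, N, hE, hN, hinv, hdiff, hrestr, hZ, hdef, hidx⟩ := hM.exists_concentrated hK hineq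
  rw [← hδ] at hdef
  have hi : (0 : ℝ) < K.index := by exact_mod_cast Nat.pos_of_ne_zero hK.index_ne_zero
  have hidx' := (mul_le_mul_of_nonneg_left hdef hi.le).trans hidx
  have hN0 : 0 < N fun _ => 1 := (mul_pos hi hpos).trans_le hidx'
  have hN1 : N (fun _ => 1) ≤ 1 := by
    refine (le_of_tendsto' (hrestr _ (bdd_const 1)) fun n => ?_).trans hone.le
    simpa [← chi_univ] using hM.chi_mono (Set.subset_univ (E n))
  obtain ⟨Ψ, hsub, hΨ, hcard, havg⟩ := exists_subnet hΦ hlim hE hinv hdiff hrestr hN0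
  have hdens : ∀ C : Set Γ, Tendsto (dens Γ Ψ C) atTop (nhds (N (chi C) / N fun _ => 1)) :=
    fun C => (havg _ (bdd_chi C)).congr fun i => (dens_eq_avg Ψ C i).symm
  refine ⟨Ψ, hsub, hΨ, isFullNet_of_tendsto havg, ?_, ⟨_, hdens _, ?_⟩,
    _, _, _, hdens A, hdens B, hdens (A + B), ?_⟩
  · rwa [hcard.liminf_eq]
  · rw [le_antisymm (hN.chi_mono (subset_add_subgroup (A + B) K)) (hN.chi_le_of_diff_eq_zero hZ)]
    exact hdens _
  · rw [← add_div, ← sub_div, le_div_iff₀ hN0]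
    exact (mul_le_of_le_one_right hpos.le hN1).trans hdef

end SumsetMeans
end

section
/- Let Γ be a discrete abelian group and let Φ = (Φ_i)_{i∈I} be a full Følner net for Γ with associated invariant mean m. Let (C_n)_{n∈ℕ} be subsets of Γ satisfying: lim_{N→∞} sup_{n,n'≥N} m(C_n Δ C_{n'}) = 0; lim_{n→∞} m(C_n Δ (C_n + γ)) = 0 for every γ ∈ Γ; and c := lim_{n→∞} m(C_n) exists with c > 0. Then there are finite sets Ψ_i ⊆ Φ_i (i ∈ I) such that (Ψ_i)_{i∈I} is a full Følner net for Γ and, for every bounded f : Γ → ℝ, the limit lim_{n→∞} m(f·1_{C_n}) exists and c⁻¹·lim_{n→∞} m(f·1_{C_n}) = lim_i (1/|Ψ_i|) Σ_{γ∈Ψ_i} f(γ). Consequently lim_i |Ψ_i|/|Φ_i| = c. -/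
open scoped Pointwise
open Filter

namespace SumsetMeans

variable (Γ : Type*) [AddCommGroup Γ] [TopologicalSpace Γ] [DiscreteTopology Γ]

variable {ι : Type*}

variable {Γ}

omit [AddCommGroup Γ] in
lemma ind_apply (A : Set Γ) (x : Γ) : ind Γ A x = A.indicator 1 x := rfl

omit [AddCommGroup Γ] in
lemma ind_nonneg (A : Set Γ) (x : Γ) : 0 ≤ ind Γ A x := by
  rw [ind_apply]
  exact Set.indicator_nonneg (fun _ _ => zero_le_one) x

omit [AddCommGroup Γ] in
lemma sum_ind (F : Finset Γ) (A : Set Γ) :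
    ∑ x ∈ F, ind Γ A x = ((A ∩ (F : Set Γ)).ncard : ℝ) := by
  classical
  have h : A ∩ (F : Set Γ) = ((F.filter (· ∈ A) : Finset Γ) : Set Γ) := by
    ext x; simp [and_comm]
  rw [h, Set.ncard_coe_finset]
  simp [ind_apply, Set.indicator_apply]

omit [AddCommGroup Γ] in
lemma abs_mul_ind_sub_le (f : BoundedContinuousFunction Γ ℝ) (A B : Set Γ) (x : Γ) :
    |f x * ind Γ A x - f x * ind Γ B x| ≤ ‖f‖ * ind Γ (symmDiff A B) x := by
  have hf : |f x| ≤ ‖f‖ := f.norm_coe_le_norm x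
  by_cases hA : x ∈ A <;> by_cases hB : x ∈ B <;>
    simp [ind_apply, Set.mem_symmDiff, hA, hB, hf]

namespace IsInvariantMean

variable {m : BoundedContinuousFunction Γ ℝ →ₗ[ℝ] ℝ}

lemma mono (hm : IsInvariantMean Γ m) {f g : BoundedContinuousFunction Γ ℝ}
    (h : ∀ x, f x ≤ g x) : m f ≤ m g := by
  have := hm.nonneg (g - f) (fun x => by simpa using h x)
  rwa [map_sub, sub_nonneg] at this

lemma abs_map_mul_ind_sub_le (hm : IsInvariantMean Γ m) (f : BoundedContinuousFunction Γ ℝ)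
    (A B : Set Γ) :
    |m (f * ind Γ A) - m (f * ind Γ B)| ≤ ‖f‖ * mVal Γ m (symmDiff A B) := by
  have h := abs_mul_ind_sub_le f A B
  have hsmul : ‖f‖ * mVal Γ m (symmDiff A B) = m (‖f‖ • ind Γ (symmDiff A B)) := by
    simp [mVal]
  rw [hsmul, ← map_sub, abs_le, ← map_neg]
  constructor <;> refine hm.mono fun x => ?_ <;> have := abs_le.1 (h x) <;>
    simp <;> linarith

end IsInvariantMean

/-- A decreasing sequence of conditions on the elements of a nonempty finite set has an element
satisfying every condition that is satisfiable at all. -/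
lemma exists_mem_forall_of_exists {α : Type*} {T : Finset α} (hT : T.Nonempty)
    {W : ℕ → α → Prop} (hW : ∀ j j' s, j ≤ j' → W j' s → W j s) :
    ∃ s ∈ T, ∀ j, (∃ s' ∈ T, W j s') → W j s := by
  by_contra! h
  choose! J hJ hJ' using h
  obtain ⟨s₀, hs₀, hmax⟩ := T.exists_max_image J hT
  obtain ⟨s, hs, hWs⟩ := hJ s₀ hs₀
  exact hJ' s hs (hW _ _ _ (hmax s hs) hWs)

omit [AddCommGroup Γ] in
/-- Given a sequence of sets that is Cauchy, at an explicit rate, for the densities along `Φ`,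
there are nonempty subsets of the `Φ i` that approximate each term of the sequence. -/
lemma exists_subset_approx {l : Filter ι} {Φ : ι → Finset Γ} (hΦ : ∀ i, (Φ i).Nonempty)
    {D : ℕ → Set Γ} {η : ℕ → ℝ}
    (hne : ∀ j, ∀ᶠ i in l, (D j ∩ (Φ i : Set Γ)).Nonempty)
    (hD : ∀ j k, k ≤ j →
      ∀ᶠ i in l, (∑ x ∈ Φ i, ind Γ (symmDiff (D j) (D k)) x) / ((Φ i).card : ℝ) < η k) :
    ∃ Ψ : ι → Finset Γ, (∀ i, Ψ i ⊆ Φ i) ∧ (∀ i, (Ψ i).Nonempty) ∧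
      ∀ k, ∀ᶠ i in l,
        (∑ x ∈ Φ i, ind Γ (symmDiff (Ψ i : Set Γ) (D k)) x) / ((Φ i).card : ℝ) < η k := by
  classical
  have key : ∀ i, ∃ S ∈ (Φ i).powerset.filter Finset.Nonempty, ∀ j,
      (∃ S' ∈ (Φ i).powerset.filter Finset.Nonempty, ∀ k ≤ j,
        (∑ x ∈ Φ i, ind Γ (symmDiff (S' : Set Γ) (D k)) x) / ((Φ i).card : ℝ) < η k) →
      ∀ k ≤ j, (∑ x ∈ Φ i, ind Γ (symmDiff (S : Set Γ) (D k)) x) / ((Φ i).card : ℝ) < η k :=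
    fun i => exists_mem_forall_of_exists ⟨Φ i, by simp [hΦ i]⟩
      (fun j j' s hjj' h k hk => h k (hk.trans hjj'))
  choose Ψ hmem hΨ using key
  simp only [Finset.mem_filter, Finset.mem_powerset] at hmem
  refine ⟨Ψ, fun i => (hmem i).1, fun i => (hmem i).2, fun j => ?_⟩
  have hall : ∀ᶠ i in l, ∀ k ∈ Finset.Iic j,
      (∑ x ∈ Φ i, ind Γ (symmDiff (D j) (D k)) x) / ((Φ i).card : ℝ) < η k :=
    (Filter.eventually_all_finset _).2 fun k hk => hD j k (Finset.mem_Iic.1 hk)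
  filter_upwards [hall, hne j] with i hi hnei
  refine hΨ i j ⟨(Φ i).filter (· ∈ D j), ?_, fun k hk => ?_⟩ j le_rfl
  · obtain ⟨x, hxD, hxΦ⟩ := hnei
    simp only [Finset.mem_filter, Finset.mem_powerset]
    exact ⟨Finset.filter_subset _ _, x, by simpa using ⟨hxΦ, hxD⟩⟩
  · refine lt_of_eq_of_lt (congrArg (· / _) (Finset.sum_congr rfl fun x hx => ?_))
      (hi k (Finset.mem_Iic.2 hk))
    simp [ind_apply, Set.indicator_apply, Set.mem_symmDiff, hx]

omit [AddCommGroup Γ] in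
/-- Averages over `Φ i` of `f` restricted to sets `Ψ i` that approximate the sets `D j` converge
to the limit of the corresponding means. -/
lemma tendsto_sum_of_approx {l : Filter ι} {Φ Ψ : ι → Finset Γ} (hsub : ∀ i, Ψ i ⊆ Φ i)
    {D : ℕ → Set Γ} {η : ℕ → ℝ} (hη : Tendsto η atTop (nhds 0))
    (happ : ∀ k, ∀ᶠ i in l,
      (∑ x ∈ Φ i, ind Γ (symmDiff (Ψ i : Set Γ) (D k)) x) / ((Φ i).card : ℝ) < η k)
    (f : BoundedContinuousFunction Γ ℝ) {a : ℕ → ℝ} {L : ℝ}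
    (ha : ∀ k, Tendsto (fun i => (∑ x ∈ Φ i, (f * ind Γ (D k)) x) / ((Φ i).card : ℝ)) l
      (nhds (a k)))
    (hL : Tendsto a atTop (nhds L)) :
    Tendsto (fun i => (∑ x ∈ Ψ i, f x) / ((Φ i).card : ℝ)) l (nhds L) := by
  rw [Metric.tendsto_nhds]
  intro ε hε
  have hη' : Tendsto (fun k => ‖f‖ * η k) atTop (nhds 0) := by simpa using hη.const_mul ‖f‖
  obtain ⟨k, hk₁, hk₂⟩ := ((hη'.eventually_lt_const (by positivity : 0 < ε / 3)).and
    (Metric.tendsto_nhds.1 hL (ε / 3) (by positivity))).exists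
  filter_upwards [happ k, Metric.tendsto_nhds.1 (ha k) (ε / 3) (by positivity)] with i h₁ h₂
  have hle : |(∑ x ∈ Ψ i, f x) / ((Φ i).card : ℝ)
      - (∑ x ∈ Φ i, (f * ind Γ (D k)) x) / ((Φ i).card : ℝ)| ≤ ‖f‖ * η k := by
    have hsum : ∑ x ∈ Ψ i, f x = ∑ x ∈ Φ i, f x * ind Γ (Ψ i : Set Γ) x := by
      classical
      simp only [ind_apply, Set.indicator_apply, Finset.mem_coe, Pi.one_apply, mul_ite, mul_one,
        mul_zero]
      rw [Finset.sum_ite_mem, Finset.inter_eq_right.2 (hsub i)]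
    rw [hsum, ← sub_div, ← Finset.sum_sub_distrib, abs_div, Nat.abs_cast]
    calc _ ≤ (∑ x ∈ Φ i, ‖f‖ * ind Γ (symmDiff (Ψ i : Set Γ) (D k)) x) / ((Φ i).card : ℝ) := by
          gcongr
          exact (Finset.abs_sum_le_sum_abs _ _).trans
            (Finset.sum_le_sum fun x _ => abs_mul_ind_sub_le f _ _ x)
      _ = ‖f‖ * ((∑ x ∈ Φ i, ind Γ (symmDiff (Ψ i : Set Γ) (D k)) x) / ((Φ i).card : ℝ)) := by
          rw [← Finset.mul_sum, mul_div_assoc]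
      _ ≤ _ := by gcongr
  rw [Real.dist_eq] at hk₂ h₂ ⊢
  rw [abs_lt] at *
  rw [abs_le] at hle
  constructor <;> linarith

omit [TopologicalSpace Γ] [DiscreteTopology Γ] in
lemma mem_add_singleton_iff (A : Set Γ) (t x : Γ) : x ∈ A + ({t} : Set Γ) ↔ x - t ∈ A := by
  simp [sub_eq_add_neg]

lemma ncard_symmDiff_add_singleton_le {F S : Finset Γ} (hSF : S ⊆ F) (D : Set Γ) (t : Γ) :
    ((symmDiff (S : Set Γ) ((S : Set Γ) + ({t} : Set Γ))).ncard : ℝ) ≤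
      2 * (∑ x ∈ F, ind Γ (symmDiff (S : Set Γ) D) x)
        + (symmDiff (F : Set Γ) ((F : Set Γ) + ({t} : Set Γ))).ncard
        + ∑ x ∈ F, ind Γ (symmDiff D (D + ({t} : Set Γ))) x := by
  set E : Set Γ := symmDiff (S : Set Γ) D ∩ F
  have hE : E.Finite := F.finite_toSet.inter_of_right _
  have hEt : (E + ({t} : Set Γ)).Finite := hE.add (Set.finite_singleton t)
  have hF : (symmDiff (F : Set Γ) ((F : Set Γ) + ({t} : Set Γ))).Finite :=
    F.finite_toSet.symmDiff (F.finite_toSet.add (Set.finite_singleton t))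
  have hD : (symmDiff D (D + ({t} : Set Γ)) ∩ F).Finite := F.finite_toSet.inter_of_right _
  have hcard : (E + ({t} : Set Γ)).ncard = E.ncard := by
    rw [Set.add_singleton]
    exact Set.ncard_image_of_injective _ (add_left_injective t)
  have hsub : symmDiff (S : Set Γ) ((S : Set Γ) + ({t} : Set Γ)) ⊆
      (E ∪ (E + ({t} : Set Γ))) ∪ symmDiff (F : Set Γ) ((F : Set Γ) + ({t} : Set Γ))
        ∪ (symmDiff D (D + ({t} : Set Γ)) ∩ F) := by
    intro x
    have h₁ := @hSF x
    have h₂ := @hSF (x - t)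
    simp only [E, Set.mem_union, Set.mem_inter_iff, Set.mem_symmDiff, mem_add_singleton_iff,
      Finset.mem_coe]
    tauto
  have hle := Set.ncard_le_ncard hsub (((hE.union hEt).union hF).union hD)
  have h₁ := Set.ncard_union_le ((E ∪ (E + ({t} : Set Γ))) ∪
    symmDiff (F : Set Γ) ((F : Set Γ) + ({t} : Set Γ))) (symmDiff D (D + ({t} : Set Γ)) ∩ F)
  have h₂ := Set.ncard_union_le (E ∪ (E + ({t} : Set Γ)))
    (symmDiff (F : Set Γ) ((F : Set Γ) + ({t} : Set Γ)))
  have h₃ := Set.ncard_union_le E (E + ({t} : Set Γ))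
  rw [sum_ind, sum_ind]
  norm_cast
  change _ ≤ 2 * E.ncard + _ + _
  omega

/-- Sets approximating, along a Følner net, a sequence of asymptotically invariant sets have
vanishing boundary relative to that net. -/
lemma tendsto_ncard_symmDiff_of_approx {l : Filter ι} {Φ Ψ : ι → Finset Γ}
    (hsub : ∀ i, Ψ i ⊆ Φ i) {D : ℕ → Set Γ} {η : ℕ → ℝ} (hη : Tendsto η atTop (nhds 0))
    (happ : ∀ k, ∀ᶠ i in l,
      (∑ x ∈ Φ i, ind Γ (symmDiff (Ψ i : Set Γ) (D k)) x) / ((Φ i).card : ℝ) < η k)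
    {t : Γ} (hΦ : Tendsto (fun i =>
      ((symmDiff (Φ i : Set Γ) ((Φ i : Set Γ) + ({t} : Set Γ))).ncard : ℝ) / ((Φ i).card : ℝ))
      l (nhds 0))
    {b : ℕ → ℝ}
    (hb : ∀ k, Tendsto (fun i => (∑ x ∈ Φ i, ind Γ (symmDiff (D k) (D k + ({t} : Set Γ))) x)
      / ((Φ i).card : ℝ)) l (nhds (b k)))
    (hb₀ : Tendsto b atTop (nhds 0)) :
    Tendsto (fun i =>
      ((symmDiff (Ψ i : Set Γ) ((Ψ i : Set Γ) + ({t} : Set Γ))).ncard : ℝ) / ((Φ i).card : ℝ))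
      l (nhds 0) := by
  refine tendsto_order.2 ⟨fun a ha => .of_forall fun i => ha.trans_le (by positivity),
    fun ε hε => ?_⟩
  have hpos : 0 < ε / 4 := by positivity
  obtain ⟨k, hk₁, hk₂⟩ := ((hη.eventually_lt_const hpos).and
    (hb₀.eventually_lt_const hpos)).exists
  filter_upwards [happ k, hΦ.eventually_lt_const hpos, (hb k).eventually_lt_const hk₂]
    with i h₁ h₂ h₃
  have := div_le_div_of_nonneg_right (ncard_symmDiff_add_singleton_le (hsub i) (D k) t)
    (Nat.cast_nonneg (α := ℝ) (Φ i).card)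
  rw [add_div, add_div, mul_div_assoc] at this
  linarith

variable (Γ)

theorem folner_from_invariant_indicator [Preorder ι] [Nonempty ι] [IsDirected ι (· ≤ ·)]
    (Φ : ι → Finset Γ) (hΦ : IsFolner Γ Φ)
    (m : BoundedContinuousFunction Γ ℝ →ₗ[ℝ] ℝ) (hm : IsInvariantMean Γ m)
    (hassoc : ∀ f : BoundedContinuousFunction Γ ℝ,
      Tendsto (fun i => (∑ γ ∈ Φ i, f γ) / ((Φ i).card : ℝ)) atTop (nhds (m f)))
    (C : ℕ → Set Γ)
    (hCauchy : ∀ ε : ℝ, 0 < ε → ∃ N : ℕ, ∀ n n' : ℕ, N ≤ n → N ≤ n' →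
      mVal Γ m (symmDiff (C n) (C n')) < ε)
    (hinv : ∀ γ : Γ,
      Tendsto (fun n => mVal Γ m (symmDiff (C n) (C n + ({γ} : Set Γ)))) atTop (nhds 0))
    (c : ℝ) (hc : Tendsto (fun n => mVal Γ m (C n)) atTop (nhds c)) (hcpos : 0 < c) :
    ∃ Ψ : ι → Finset Γ, (∀ i, Ψ i ⊆ Φ i) ∧ IsFolner Γ Ψ ∧ IsFullNet Γ Ψ ∧
      (∀ f : BoundedContinuousFunction Γ ℝ, ∃ L : ℝ,
        Tendsto (fun n => m (f * ind Γ (C n))) atTop (nhds L) ∧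
        Tendsto (fun i => (∑ γ ∈ Ψ i, f γ) / ((Ψ i).card : ℝ)) atTop (nhds (c⁻¹ * L))) ∧
      Tendsto (fun i => ((Ψ i).card : ℝ) / ((Φ i).card : ℝ)) atTop (nhds c) := by
  have hP : ∀ j : ℕ, ∀ᶠ k in atTop,
      (∀ n, k ≤ n → mVal Γ m (symmDiff (C n) (C k)) < (1 / 2 : ℝ) ^ j) ∧ 0 < mVal Γ m (C k) := by
    intro j
    obtain ⟨N, hN⟩ := hCauchy ((1 / 2 : ℝ) ^ j) (by positivity)
    filter_upwards [eventually_ge_atTop N, hc.eventually_const_lt hcpos] with k hk hk'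
    exact ⟨fun n hn => hN n k (hk.trans hn) hk, hk'⟩
  obtain ⟨φ, hφ, hφP⟩ := extraction_forall_of_eventually hP
  have hη : Tendsto (fun j : ℕ => (1 / 2 : ℝ) ^ j) atTop (nhds 0) :=
    tendsto_pow_atTop_nhds_zero_of_lt_one (by norm_num) (by norm_num)
  obtain ⟨Ψ, hsub, hne, happ⟩ := exists_subset_approx (l := atTop) hΦ.1 (D := fun j => C (φ j))
    (η := fun j => (1 / 2 : ℝ) ^ j)
    (fun j => by
      filter_upwards [(hassoc (ind Γ (C (φ j)))).eventually_const_lt (hφP j).2] with i hi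
      rw [sum_ind] at hi
      by_contra hempty
      simp [Set.not_nonempty_iff_eq_empty.1 hempty] at hi)
    (fun j k hkj => (hassoc _).eventually_lt_const ((hφP k).1 _ (hφ.monotone hkj)))
  have hlim : ∀ f : BoundedContinuousFunction Γ ℝ, ∃ L : ℝ,
      Tendsto (fun n => m (f * ind Γ (C n))) atTop (nhds L) := by
    refine fun f => cauchySeq_tendsto_of_complete (Metric.cauchySeq_iff.2 fun ε hε => ?_)
    obtain ⟨N, hN⟩ := hCauchy (ε / (‖f‖ + 1)) (by positivity)
    refine ⟨N, fun n hn n' hn' => ?_⟩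
    have h₁ := hm.abs_map_mul_ind_sub_le f (C n) (C n')
    have h₂ := hN n n' hn hn'
    rw [lt_div_iff₀ (by positivity)] at h₂
    have h₃ : 0 ≤ mVal Γ m (symmDiff (C n) (C n')) := hm.nonneg _ (ind_nonneg _)
    rw [Real.dist_eq]
    linarith
  have hsum : ∀ (f : BoundedContinuousFunction Γ ℝ) (L : ℝ),
      Tendsto (fun n => m (f * ind Γ (C n))) atTop (nhds L) →
      Tendsto (fun i => (∑ x ∈ Ψ i, f x) / ((Φ i).card : ℝ)) atTop (nhds L) :=
    fun f L hL => tendsto_sum_of_approx hsub hη happ f (fun k => hassoc _)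
      (hL.comp hφ.tendsto_atTop)
  have hcard : Tendsto (fun i => ((Ψ i).card : ℝ) / ((Φ i).card : ℝ)) atTop (nhds c) := by
    simpa using hsum 1 c (by simpa [mVal] using hc)
  have hΦ₀ : ∀ i, ((Φ i).card : ℝ) ≠ 0 := fun i => by
    simpa using (hΦ.1 i).ne_empty
  have hrenorm : ∀ (u : ι → ℝ) (L : ℝ),
      Tendsto (fun i => u i / ((Φ i).card : ℝ)) atTop (nhds L) →
      Tendsto (fun i => u i / ((Ψ i).card : ℝ)) atTop (nhds (c⁻¹ * L)) := by
    intro u L hu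
    rw [inv_mul_eq_div]
    refine (hu.div hcard hcpos.ne').congr fun i => ?_
    exact div_div_div_cancel_right₀ (hΦ₀ i) _ _
  have hmean : ∀ f : BoundedContinuousFunction Γ ℝ, ∃ L : ℝ,
      Tendsto (fun n => m (f * ind Γ (C n))) atTop (nhds L) ∧
      Tendsto (fun i => (∑ γ ∈ Ψ i, f γ) / ((Ψ i).card : ℝ)) atTop (nhds (c⁻¹ * L)) := by
    intro f
    obtain ⟨L, hL⟩ := hlim f
    exact ⟨L, hL, hrenorm _ L (hsum f L hL)⟩
  refine ⟨Ψ, hsub, ⟨hne, fun t => ?_⟩, fun f => ?_, hmean, hcard⟩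
  · rw [← mul_zero c⁻¹]
    exact hrenorm _ 0 (tendsto_ncard_symmDiff_of_approx hsub hη happ (hΦ.2 t)
      (fun k => hassoc _) ((hinv t).comp hφ.tendsto_atTop))
  · obtain ⟨L, -, hL⟩ := hmean f
    exact ⟨_, hL⟩

end SumsetMeans
end
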